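/- arXiv:1207.5097 — 5 statements merged into one kernel-verified Lean document; each statement's English description precedes it below -/
import Mathlib

section
/- Let n ≥ 1 be an integer and let f satisfy the model assumption and the normalization ∫₀^∞∫_ℝ s^{n-1} f(x²+s²) dx ds = 1. Take the scale invariant L^p loss ρ(t) = |t|^p with p ∈ (0,1), so ρ'(t) = p|t|^{p-1} sgn(t), the MRE constant is c₀ = 0, and the MRE estimator is δ₀(x,s) = x. Let g_{π0} : ℝ → ℝ be a locally absolutely continuous, nonincreasing function with lim_{y→∞} g_{π0}(y) = 0 satisfying ∫₀^∞∫_{-∞}^{vy} ρ'(u + g_{π0}(y)v) vⁿ f(u²+v²) du dv = 0 and y + g_{π0}(y) ≥ 0 for every y. Assume all risks below are finite. Then δ_{π0}(x,s) = x + g_{π0}(x/s)s satisfies R((μ,σ), δ_{π0}) ≤ R((μ,σ), δ₀) for every μ ≥ 0 and σ > 0. -/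
open MeasureTheory Set Filter

/-- Risk of the estimator `δ` at `(μ, σ)` under loss `ρ((d-μ)/σ)` in the
location–scale model `p_{μ,σ}(x,s) = σ^{-(n+1)} s^{n-1} f(((x-μ)²+s²)/σ²)`. -/
noncomputable def risk (n : ℕ) (f ρ : ℝ → ℝ) (δ : ℝ → ℝ → ℝ) (μ σ : ℝ) : ℝ :=
  ∫ s in Ioi (0 : ℝ), ∫ x : ℝ,
    ρ ((δ x s - μ) / σ) * (s ^ (n - 1) / σ ^ (n + 1) * f (((x - μ) ^ 2 + s ^ 2) / σ ^ 2))

/-- The odd power function `x ↦ |x| ^ (p - 1) * sign x`, proportional to the derivative of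
`|x| ^ p`. -/
noncomputable def signedPow (p x : ℝ) : ℝ := |x| ^ (p - 1) * Real.sign x

lemma signedPow_of_pos (p : ℝ) {x : ℝ} (hx : 0 < x) : signedPow p x = x ^ (p - 1) := by
  simp [signedPow, Real.sign_of_pos hx, abs_of_pos hx]

lemma signedPow_neg (p x : ℝ) : signedPow p (-x) = -signedPow p x := by
  simp [signedPow, Real.sign_neg]

lemma signedPow_pos (p : ℝ) {x : ℝ} (hx : 0 < x) : 0 < signedPow p x := by
  rw [signedPow_of_pos p hx]; positivity

lemma signedPow_nonneg (p : ℝ) {x : ℝ} (hx : 0 ≤ x) : 0 ≤ signedPow p x := by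
  rcases hx.eq_or_lt with rfl | hx
  · simp [signedPow]
  · exact (signedPow_pos p hx).le

lemma signedPow_nonpos (p : ℝ) {x : ℝ} (hx : x ≤ 0) : signedPow p x ≤ 0 := by
  have := signedPow_nonneg p (neg_nonneg.2 hx)
  rw [signedPow_neg] at this; linarith

lemma signedPow_le_of_le {p : ℝ} (hp : p ≤ 1) {x y : ℝ} (hx : 0 < x) (hxy : x ≤ y) :
    signedPow p y ≤ signedPow p x := by
  rw [signedPow_of_pos p hx, signedPow_of_pos p (hx.trans_le hxy)]
  exact Real.rpow_le_rpow_of_nonpos hx hxy (by linarith)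

lemma signedPow_mul (p : ℝ) {c : ℝ} (hc : 0 < c) (x : ℝ) :
    signedPow p (c * x) = c ^ (p - 1) * signedPow p x := by
  have hs : Real.sign (c * x) = Real.sign x := by
    rcases lt_trichotomy x 0 with h | rfl | h
    · rw [Real.sign_of_neg h, Real.sign_of_neg (mul_neg_of_pos_of_neg hc h)]
    · simp
    · rw [Real.sign_of_pos h, Real.sign_of_pos (mul_pos hc h)]
  rw [signedPow, signedPow, hs, abs_mul, abs_of_pos hc,
    Real.mul_rpow hc.le (abs_nonneg x), mul_assoc]

lemma abs_signedPow_le (p x : ℝ) : |signedPow p x| ≤ |x| ^ (p - 1) := by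
  have h : |Real.sign x| ≤ 1 := by
    rcases Real.sign_apply_eq x with h | h | h <;> simp [h]
  rw [signedPow, abs_mul, abs_of_nonneg (by positivity : 0 ≤ |x| ^ (p - 1))]
  exact mul_le_of_le_one_right (by positivity) h

lemma measurable_signedPow (p : ℝ) : Measurable (signedPow p) := by
  have h : Measurable Real.sign := by
    unfold Real.sign
    exact Measurable.ite measurableSet_Iio measurable_const
      (Measurable.ite measurableSet_Ioi measurable_const measurable_const)
  unfold signedPow
  fun_prop

lemma intervalIntegrable_abs_rpow {r : ℝ} (hr : -1 < r) (a b : ℝ) :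
    IntervalIntegrable (fun x : ℝ => |x| ^ r) volume a b := by
  refine intervalIntegrable_of_even (fun x => by simp) fun x hx => ?_
  refine (intervalIntegral.intervalIntegrable_rpow' (a := 0) (b := x) hr).congr ?_
  intro y hy
  rw [uIoc_of_le hx.le] at hy
  simp only [abs_of_pos hy.1]

lemma intervalIntegrable_signedPow {p : ℝ} (hp : 0 < p) (a b : ℝ) :
    IntervalIntegrable (signedPow p) volume a b := by
  refine (intervalIntegrable_abs_rpow (r := p - 1) (by linarith) a b).mono_fun
    (measurable_signedPow p).aestronglyMeasurable (Eventually.of_forall fun x => ?_)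
  beta_reduce
  rw [Real.norm_eq_abs, Real.norm_of_nonneg (by positivity)]
  exact abs_signedPow_le p x

lemma integral_signedPow {p : ℝ} (hp : 0 < p) (a b : ℝ) :
    ∫ x in a..b, p * signedPow p x = |b| ^ p - |a| ^ p := by
  refine integral_eq_of_hasDerivAt_off_countable (fun x => |x| ^ p) _ (countable_singleton 0)
    (continuous_abs.rpow_const fun _ => Or.inr hp.le).continuousOn ?_
    ((intervalIntegrable_signedPow hp a b).const_mul p)
  rintro x ⟨-, hx⟩
  convert! (hasDerivAt_abs hx).rpow_const (p := p) (Or.inl (abs_ne_zero.2 hx)) using 1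
  rcases lt_or_gt_of_ne hx with h | h
  · simp [signedPow, Real.sign_of_neg h, h]
  · simp [signedPow, Real.sign_of_pos h, h]

lemma integral_abs_rpow_le {p : ℝ} (hp : 0 < p) (a b : ℝ) :
    ∫ x in a..b, p * |x| ^ (p - 1) ≤ |b| ^ p + |a| ^ p := by
  have hbd : ∀ x : ℝ, |Real.sign x * |x| ^ p| ≤ |x| ^ p := fun x => by
    have h : |Real.sign x| ≤ 1 := by
      rcases Real.sign_apply_eq x with h | h | h <;> simp [h]
    rw [abs_mul, abs_of_nonneg (by positivity : 0 ≤ |x| ^ p)]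
    exact mul_le_of_le_one_left (by positivity) h
  have hc : Continuous fun x : ℝ => (max x 0) ^ p - (max (-x) 0) ^ p := by
    refine Continuous.sub ?_ ?_
    · exact (continuous_id.max continuous_const).rpow_const fun _ => Or.inr hp.le
    · exact (continuous_neg.max continuous_const).rpow_const fun _ => Or.inr hp.le
  have heq : (fun x : ℝ => Real.sign x * |x| ^ p) =
      fun x : ℝ => (max x 0) ^ p - (max (-x) 0) ^ p := by
    funext x
    rcases lt_trichotomy x 0 with h | rfl | h
    · simp [Real.sign_of_neg h, abs_of_neg h, h.le, Real.zero_rpow hp.ne']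
    · simp
    · simp [Real.sign_of_pos h, abs_of_pos h, h.le, Real.zero_rpow hp.ne']
  have key := integral_eq_of_hasDerivAt_off_countable (a := a) (b := b)
    (fun x : ℝ => Real.sign x * |x| ^ p)
    (fun x => p * |x| ^ (p - 1)) (countable_singleton 0) (heq ▸ hc).continuousOn ?_
    ((intervalIntegrable_abs_rpow (by linarith) a b).const_mul p)
  · rw [key]
    have := abs_le.1 (hbd b)
    have := abs_le.1 (hbd a)
    linarith
  rintro x ⟨-, hx⟩
  have h1 := (hasDerivAt_abs hx).rpow_const (p := p) (Or.inl (abs_ne_zero.2 hx))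
  rcases lt_or_gt_of_ne hx with h | h
  · refine (h1.neg.congr_of_eventuallyEq ?_).congr_deriv ?_
    · filter_upwards [Iio_mem_nhds h] with y hy
      simp [Real.sign_of_neg hy]
    · simp [h]
  · refine (h1.congr_of_eventuallyEq ?_).congr_deriv ?_
    · filter_upwards [Ioi_mem_nhds h] with y hy
      simp [Real.sign_of_pos hy]
    · simp [h]

/-- The angular part of the Bayes equation in polar coordinates: boundary angle `α`,
sign change at `θ₀`. -/
noncomputable def angularKernel (n : ℕ) (p α θ₀ : ℝ) : ℝ → ℝ :=
  (Ioo α Real.pi).indicator fun θ => signedPow p (Real.sin (θ₀ - θ)) * Real.sin θ ^ n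

section angular

variable {n : ℕ} {p α θ₀ : ℝ}

lemma angularKernel_of_mem {θ : ℝ} (h : θ ∈ Ioo α Real.pi) :
    angularKernel n p α θ₀ θ = signedPow p (Real.sin (θ₀ - θ)) * Real.sin θ ^ n :=
  indicator_of_mem h _

lemma angularKernel_of_notMem {θ : ℝ} (h : θ ∉ Ioo α Real.pi) :
    angularKernel n p α θ₀ θ = 0 :=
  indicator_of_notMem h _

lemma angularKernel_pos (hα : 0 < α) (hθ₀ : θ₀ < Real.pi) {θ : ℝ} (h1 : α < θ) (h2 : θ < θ₀) :
    0 < angularKernel n p α θ₀ θ := by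
  rw [angularKernel_of_mem ⟨h1, h2.trans hθ₀⟩]
  exact mul_pos (signedPow_pos p (Real.sin_pos_of_pos_of_lt_pi (by linarith) (by linarith)))
    (pow_pos (Real.sin_pos_of_pos_of_lt_pi (by linarith) (by linarith)) n)

lemma angularKernel_nonneg (hα : 0 < α) (hθ₀ : θ₀ < Real.pi) {θ : ℝ} (h : θ ≤ θ₀) :
    0 ≤ angularKernel n p α θ₀ θ := by
  by_cases hm : θ ∈ Ioo α Real.pi
  · rcases h.eq_or_lt with rfl | h
    · simp [angularKernel_of_mem hm, signedPow]
    · exact (angularKernel_pos hα hθ₀ hm.1 h).le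
  · rw [angularKernel_of_notMem hm]

lemma angularKernel_nonpos (hα : 0 < α) (hθ₀ : 0 < θ₀) {θ : ℝ} (h : θ₀ ≤ θ) :
    angularKernel n p α θ₀ θ ≤ 0 := by
  by_cases hm : θ ∈ Ioo α Real.pi
  · rw [angularKernel_of_mem hm]
    have h1 := hm.1
    have h2 := hm.2
    refine mul_nonpos_of_nonpos_of_nonneg (signedPow_nonpos p ?_)
      (pow_nonneg (Real.sin_nonneg_of_nonneg_of_le_pi (by linarith) (by linarith)) n)
    exact Real.sin_nonpos_of_nonpos_of_neg_pi_le (by linarith) (by linarith)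
  · rw [angularKernel_of_notMem hm]

/-- A balanced angular kernel cannot change sign beyond the normal direction `α + π / 2`. -/
lemma le_of_integral_angularKernel_eq_zero (hα : 0 < α) (hθ₀ : θ₀ < Real.pi)
    (hint : Integrable (angularKernel n p α θ₀))
    (hzero : ∫ θ, angularKernel n p α θ₀ θ = 0) : θ₀ ≤ α + Real.pi / 2 := by
  by_contra! hlt
  set A := angularKernel n p α θ₀ with hA
  have hint' : Integrable fun θ => A (2 * θ₀ - θ) := hint.comp_sub_left (2 * θ₀)
  have hsum : ∫ θ, (A θ + A (2 * θ₀ - θ)) = 0 := by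
    rw [integral_add hint hint', integral_sub_left_eq_self, hzero, add_zero]
  have hnn_left : ∀ θ ≤ θ₀, 0 ≤ A θ + A (2 * θ₀ - θ) := by
    intro θ hθ
    by_cases hm : 2 * θ₀ - θ < Real.pi
    · have h1 : θ ∈ Ioo α Real.pi := ⟨by linarith, by linarith⟩
      have h2 : 2 * θ₀ - θ ∈ Ioo α Real.pi := ⟨by linarith, hm⟩
      rw [hA, angularKernel_of_mem h1, angularKernel_of_mem h2,
        show θ₀ - (2 * θ₀ - θ) = -(θ₀ - θ) by ring, Real.sin_neg, signedPow_neg, neg_mul,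
        ← sub_eq_add_neg, ← mul_sub]
      refine mul_nonneg (signedPow_nonneg p
        (Real.sin_nonneg_of_nonneg_of_le_pi (by linarith) (by linarith))) (sub_nonneg.2 ?_)
      refine pow_le_pow_left₀
        (Real.sin_nonneg_of_nonneg_of_le_pi (by linarith) (by linarith)) ?_ n
      have h3 := Real.sin_sub_sin (2 * θ₀ - θ) θ
      rw [show (2 * θ₀ - θ - θ) / 2 = θ₀ - θ by ring, show (2 * θ₀ - θ + θ) / 2 = θ₀ by ring] at h3
      have h4 : 0 ≤ Real.sin (θ₀ - θ) :=
        Real.sin_nonneg_of_nonneg_of_le_pi (by linarith) (by linarith)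
      have h5 : Real.cos θ₀ ≤ 0 :=
        Real.cos_nonpos_of_pi_div_two_le_of_le (by linarith) (by linarith)
      nlinarith
    · rw [hA, angularKernel_of_notMem (θ := 2 * θ₀ - θ) fun h => hm h.2, add_zero]
      exact angularKernel_nonneg hα hθ₀ hθ
  have hnn : 0 ≤ fun θ => A θ + A (2 * θ₀ - θ) := by
    intro θ
    rcases le_total θ θ₀ with h | h
    · exact hnn_left θ h
    · have := hnn_left (2 * θ₀ - θ) (by linarith)
      rw [sub_sub_cancel] at this
      simpa [add_comm] using this
  have hpos : 0 < ∫ θ, (A θ + A (2 * θ₀ - θ)) := by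
    rw [integral_pos_iff_support_of_nonneg hnn (hint.add hint')]
    have hsub : Ioo α (2 * θ₀ - Real.pi) ⊆ Function.support fun θ => A θ + A (2 * θ₀ - θ) := by
      intro θ hθ
      have h1 := hθ.1
      have h2 := hθ.2
      have h3 : A (2 * θ₀ - θ) = 0 := angularKernel_of_notMem fun h => by linarith [h.2]
      rw [Function.mem_support, h3, add_zero]
      exact (angularKernel_pos hα hθ₀ h1 (by linarith)).ne'
    refine lt_of_lt_of_le ?_ (measure_mono hsub)
    rw [Real.volume_Ioo, ENNReal.ofReal_pos]
    linarith
  exact hpos.ne' hsum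

/-- A balanced angular kernel integrates nonpositively against nondecreasing functions of the
distance to the boundary line. -/
lemma integral_angularKernel_mul_nonpos (hp : p ≤ 1) (hα : 0 < α) (hαθ : α ≤ θ₀)
    (hθ₀ : θ₀ < Real.pi) (hint : Integrable (angularKernel n p α θ₀))
    (hzero : ∫ θ, angularKernel n p α θ₀ θ = 0) {Ψ : ℝ → ℝ} (hΨ : Monotone Ψ)
    (hintΨ : Integrable fun θ => angularKernel n p α θ₀ θ * Ψ (Real.sin (θ - α))) :
    ∫ θ, angularKernel n p α θ₀ θ * Ψ (Real.sin (θ - α)) ≤ 0 := by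
  have hle := le_of_integral_angularKernel_eq_zero hα hθ₀ hint hzero
  set A := angularKernel n p α θ₀ with hA
  set K := Ψ (Real.sin (θ₀ - α)) with hK
  set E : ℝ → ℝ := fun θ => A θ * (Ψ (Real.sin (θ - α)) - K) with hE
  set c := 2 * α + Real.pi with hc
  have hEsub : E = fun θ => A θ * Ψ (Real.sin (θ - α)) - A θ * K := by
    funext θ; simp only [hE]; ring
  have hEint : Integrable E := hEsub ▸ hintΨ.sub (hint.mul_const K)
  have hEval : ∫ θ, E θ = ∫ θ, A θ * Ψ (Real.sin (θ - α)) := by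
    rw [hEsub, integral_sub hintΨ (hint.mul_const K), integral_mul_const, hzero]; simp
  have hEint' : Integrable fun θ => E (c - θ) := hEint.comp_sub_left c
  have hleft : ∀ θ ≤ α + Real.pi / 2, E θ + E (c - θ) ≤ 0 := by
    intro θ hθ
    rcases le_or_gt θ α with h1 | h1
    · have e1 : A θ = 0 := angularKernel_of_notMem fun h => by linarith [h.1]
      have e2 : A (c - θ) = 0 := angularKernel_of_notMem fun h => by linarith [h.2]
      simp [hE, e1, e2]
    have hEθ : E θ ≤ 0 := by
      rcases le_total θ θ₀ with h | h
      · refine mul_nonpos_of_nonneg_of_nonpos (angularKernel_nonneg hα hθ₀ h) (sub_nonpos.2 (hΨ ?_))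
        exact Real.sin_le_sin_of_le_of_le_pi_div_two (by linarith) (by linarith) (by linarith)
      · refine mul_nonpos_of_nonpos_of_nonneg (angularKernel_nonpos hα (by linarith) h)
          (sub_nonneg.2 (hΨ ?_))
        exact Real.sin_le_sin_of_le_of_le_pi_div_two (by linarith) (by linarith) (by linarith)
    rcases le_or_gt Real.pi (c - θ) with h2 | h2
    · have e2 : A (c - θ) = 0 := angularKernel_of_notMem fun h => by linarith [h.2]
      simpa [hE, e2] using hEθ
    have hsin : Real.sin (c - θ - α) = Real.sin (θ - α) := by
      rw [← Real.sin_pi_sub]; congr 1; rw [hc]; ring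
    have hsplit : E θ + E (c - θ) = (A θ + A (c - θ)) * (Ψ (Real.sin (θ - α)) - K) := by
      simp only [hE, hsin]; ring
    rw [hsplit]
    rcases le_or_gt θ₀ θ with h | h
    · refine mul_nonpos_of_nonpos_of_nonneg (add_nonpos
        (angularKernel_nonpos hα (by linarith) h)
        (angularKernel_nonpos hα (by linarith) (by linarith))) (sub_nonneg.2 (hΨ ?_))
      exact Real.sin_le_sin_of_le_of_le_pi_div_two (by linarith) (by linarith) (by linarith)
    · refine mul_nonpos_of_nonneg_of_nonpos ?_ (sub_nonpos.2 (hΨ ?_))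
      · have m1 : θ ∈ Ioo α Real.pi := ⟨h1, by linarith⟩
        have m2 : c - θ ∈ Ioo α Real.pi := ⟨by linarith, h2⟩
        rw [hA, angularKernel_of_mem m1, angularKernel_of_mem m2,
          show θ₀ - (c - θ) = -(c - θ - θ₀) by ring, Real.sin_neg, signedPow_neg, neg_mul,
          ← sub_eq_add_neg, sub_nonneg]
        have s1 : Real.sin (θ₀ - θ) ≤ Real.sin (c - θ - θ₀) := by
          have h3 := Real.sin_sub_sin (c - θ - θ₀) (θ₀ - θ)
          rw [show (c - θ - θ₀ - (θ₀ - θ)) / 2 = α + Real.pi / 2 - θ₀ by rw [hc]; ring,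
            show (c - θ - θ₀ + (θ₀ - θ)) / 2 = α + Real.pi / 2 - θ by rw [hc]; ring] at h3
          have h4 : 0 ≤ Real.sin (α + Real.pi / 2 - θ₀) :=
            Real.sin_nonneg_of_nonneg_of_le_pi (by linarith) (by linarith)
          have h5 : 0 ≤ Real.cos (α + Real.pi / 2 - θ) :=
            Real.cos_nonneg_of_neg_pi_div_two_le_of_le (by linarith) (by linarith)
          have := mul_nonneg h4 h5
          linarith
        have s2 : Real.sin (c - θ) ≤ Real.sin θ := by
          have h3 := Real.sin_sub_sin (c - θ) θ
          rw [show (c - θ - θ) / 2 = Real.pi / 2 - (θ - α) by rw [hc]; ring,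
            show (c - θ + θ) / 2 = α + Real.pi / 2 by rw [hc]; ring,
            Real.sin_pi_div_two_sub, Real.cos_add_pi_div_two] at h3
          have h4 : 0 ≤ Real.cos (θ - α) :=
            Real.cos_nonneg_of_neg_pi_div_two_le_of_le (by linarith) (by linarith)
          have h5 : 0 ≤ Real.sin α :=
            Real.sin_nonneg_of_nonneg_of_le_pi (by linarith) (by linarith)
          have := mul_nonneg h4 h5
          linarith
        have s3 : 0 < Real.sin (θ₀ - θ) :=
          Real.sin_pos_of_pos_of_lt_pi (by linarith) (by linarith)
        have s4 : 0 ≤ Real.sin (c - θ) :=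
          Real.sin_nonneg_of_nonneg_of_le_pi (by linarith) (by linarith)
        exact mul_le_mul (signedPow_le_of_le hp s3 s1) (pow_le_pow_left₀ s4 s2 n)
          (pow_nonneg s4 n) (signedPow_nonneg p s3.le)
      · exact Real.sin_le_sin_of_le_of_le_pi_div_two (by linarith) (by linarith) (by linarith)
  have hpt : ∀ θ, E θ + E (c - θ) ≤ 0 := by
    intro θ
    rcases le_total θ (α + Real.pi / 2) with h | h
    · exact hleft θ h
    · have := hleft (c - θ) (by linarith)
      rw [sub_sub_cancel] at this
      linarith
  have hsum : ∫ θ, (E θ + E (c - θ)) = (∫ θ, E θ) + ∫ θ, E θ := by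
    rw [integral_add hEint hEint', integral_sub_left_eq_self E volume c]
  have := integral_nonpos (μ := volume) (f := fun θ => E θ + E (c - θ)) hpt
  linarith

end angular

/-- The wedge `{v > 0, u + μ < t v}` on which the Bayes equation is integrated. -/
def wedge (t μ : ℝ) : Set (ℝ × ℝ) := {q | 0 < q.2 ∧ q.1 + μ < t * q.2}

/-- The integrand of the Bayes equation with slope `γ` and density `F`. -/
noncomputable def bayesIntegrand (n : ℕ) (p : ℝ) (F : ℝ → ℝ) (γ : ℝ) (q : ℝ × ℝ) : ℝ :=
  signedPow p (q.1 + γ * q.2) * q.2 ^ n * F (q.1 ^ 2 + q.2 ^ 2)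

/-- The integrand of the Bayes equation over a wedge, in polar coordinates `(r, θ)`, up to a
positive constant. -/
noncomputable def polarIntegrand (n : ℕ) (p : ℝ) (F : ℝ → ℝ) (t μ γ : ℝ) (q : ℝ × ℝ) : ℝ :=
  angularKernel n p (Real.pi / 2 - Real.arctan t) (Real.pi / 2 + Real.arctan γ) q.2 *
    if μ * Real.cos (Real.arctan t) < q.1 * Real.sin (q.2 - (Real.pi / 2 - Real.arctan t))
    then q.1 ^ (n + p) * F (q.1 ^ 2) else 0

lemma cos_add_mul_sin_eq (γ θ : ℝ) :
    Real.cos θ + γ * Real.sin θ =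
      (Real.cos (Real.arctan γ))⁻¹ * Real.sin (Real.pi / 2 + Real.arctan γ - θ) := by
  have h := (Real.cos_arctan_pos γ).ne'
  have h1 : Real.sin (Real.arctan γ) = γ * Real.cos (Real.arctan γ) := by
    rw [← Real.tan_mul_cos h, Real.tan_arctan]
  rw [show Real.pi / 2 + Real.arctan γ - θ = Real.pi / 2 - (θ - Real.arctan γ) by ring,
    Real.sin_pi_div_two_sub, Real.cos_sub, h1]
  field_simp

lemma cos_arctan_mul_sub (t θ : ℝ) :
    Real.cos (Real.arctan t) * (t * Real.sin θ - Real.cos θ) =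
      Real.sin (θ - (Real.pi / 2 - Real.arctan t)) := by
  have h := (Real.cos_arctan_pos t).ne'
  have h1 : Real.sin (Real.arctan t) = t * Real.cos (Real.arctan t) := by
    rw [← Real.tan_mul_cos h, Real.tan_arctan]
  rw [show θ - (Real.pi / 2 - Real.arctan t) = -(Real.pi / 2 - (θ + Real.arctan t)) by ring,
    Real.sin_neg, Real.sin_pi_div_two_sub, Real.cos_add, h1]
  ring

lemma polar_bayesIntegrand (n : ℕ) (p : ℝ) (F : ℝ → ℝ) (t γ : ℝ) {μ : ℝ} (hμ : 0 ≤ μ)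
    {q : ℝ × ℝ} (hq : q ∈ polarCoord.target) :
    q.1 • (wedge t μ).indicator (bayesIntegrand n p F γ) (polarCoord.symm q) =
      (Real.cos (Real.arctan γ))⁻¹ ^ (p - 1) * polarIntegrand n p F t μ γ q := by
  obtain ⟨r, θ⟩ := q
  rw [polarCoord_target] at hq
  have hr : 0 < r := hq.1
  have hθ1 : -Real.pi < θ := hq.2.1
  have hθ2 : θ < Real.pi := hq.2.2
  have hct := Real.cos_arctan_pos t
  have hcg := Real.cos_arctan_pos γ
  set α := Real.pi / 2 - Real.arctan t with hα
  have hα0 : 0 < α := by have := Real.arctan_lt_pi_div_two t; linarith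
  have hαπ : α < Real.pi := by have := Real.neg_pi_div_two_lt_arctan t; linarith
  have hmem : (r * Real.cos θ, r * Real.sin θ) ∈ wedge t μ ↔
      0 < Real.sin θ ∧ μ * Real.cos (Real.arctan t) < r * Real.sin (θ - α) := by
    simp only [wedge, mem_ofPred_eq]
    refine and_congr (mul_pos_iff_of_pos_left hr) ?_
    rw [hα, ← cos_arctan_mul_sub, mul_comm μ, mul_left_comm r, mul_lt_mul_iff_right₀ hct]
    constructor <;> intro h <;> linarith
  simp only [polarCoord_symm_apply, polarIntegrand, ← hα]
  by_cases hlt : μ * Real.cos (Real.arctan t) < r * Real.sin (θ - α)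
  · rw [if_pos hlt]
    by_cases hs : 0 < Real.sin θ
    · have hθ0 : 0 < θ := by
        by_contra! h
        exact hs.not_ge (Real.sin_nonpos_of_nonpos_of_neg_pi_le h hθ1.le)
      have hαθ : α < θ := by
        by_contra! h
        have h1 : Real.sin (θ - α) ≤ 0 :=
          Real.sin_nonpos_of_nonpos_of_neg_pi_le (by linarith) (by linarith)
        have := mul_nonpos_of_nonneg_of_nonpos hr.le h1
        have := mul_nonneg hμ hct.le
        linarith
      rw [indicator_of_mem (hmem.2 ⟨hs, hlt⟩), angularKernel_of_mem ⟨hαθ, hθ2⟩]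
      simp only [bayesIntegrand]
      rw [show r * Real.cos θ + γ * (r * Real.sin θ) = r * (Real.cos θ + γ * Real.sin θ) by ring,
        cos_add_mul_sin_eq, signedPow_mul p hr, signedPow_mul p (inv_pos.2 hcg),
        show (r * Real.cos θ) ^ 2 + (r * Real.sin θ) ^ 2
          = r ^ 2 * (Real.sin θ ^ 2 + Real.cos θ ^ 2) by ring, Real.sin_sq_add_cos_sq, mul_one,
        mul_pow, Real.rpow_add hr, Real.rpow_natCast, Real.rpow_sub_one hr.ne', smul_eq_mul]
      field_simp
    · rw [indicator_of_notMem fun h => hs (hmem.1 h).1, angularKernel_of_notMem fun h => hs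
        (Real.sin_pos_of_pos_of_lt_pi (hα0.trans h.1) h.2)]
      simp
  · rw [indicator_of_notMem fun h => hlt (hmem.1 h).2, if_neg hlt]
    simp

lemma polarIntegrand_eq_zero (n : ℕ) (p : ℝ) (F : ℝ → ℝ) (t μ γ : ℝ) :
    ∀ q ∈ (Ioi (0 : ℝ) ×ˢ univ) \ polarCoord.target, polarIntegrand n p F t μ γ q = 0 := by
  rintro ⟨r, θ⟩ ⟨h1, h2⟩
  have hα : 0 < Real.pi / 2 - Real.arctan t := by
    have := Real.arctan_lt_pi_div_two t; linarith
  rw [polarIntegrand, angularKernel_of_notMem, zero_mul]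
  intro h
  rw [polarCoord_target] at h2
  exact h2 ⟨h1.1, by have := h.1; have := Real.pi_pos; simp only at *; linarith, h.2⟩

lemma integrableOn_polarIntegrand {n : ℕ} {p : ℝ} {F : ℝ → ℝ} {t μ γ : ℝ} (hμ : 0 ≤ μ)
    (h : Integrable ((wedge t μ).indicator (bayesIntegrand n p F γ))) :
    IntegrableOn (polarIntegrand n p F t μ γ) (Ioi 0 ×ˢ univ) := by
  have hm := polarCoord.open_target.measurableSet
  have h1 := (integrableOn_image_iff_integrableOn_abs_det_fderiv_smul volume hm
    (fun q _ => (hasFDerivAt_polarCoord_symm q).hasFDerivWithinAt) polarCoord.symm.injOn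
    ((wedge t μ).indicator (bayesIntegrand n p F γ))).1 h.integrableOn
  have hC : (Real.cos (Real.arctan γ))⁻¹ ^ (p - 1) ≠ 0 :=
    (Real.rpow_pos_of_pos (inv_pos.2 (Real.cos_arctan_pos γ)) _).ne'
  have h2 : IntegrableOn (fun q => (Real.cos (Real.arctan γ))⁻¹ ^ (p - 1) *
      polarIntegrand n p F t μ γ q) polarCoord.target := by
    refine h1.congr_fun (fun q hq => ?_) hm
    have hq1 : 0 < q.1 := by rw [polarCoord_target] at hq; exact hq.1
    beta_reduce
    rw [det_fderivPolarCoordSymm, abs_of_pos hq1, polar_bayesIntegrand n p F t γ hμ hq]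
  refine IntegrableOn.of_forall_sdiff_eq_zero ((integrable_const_mul_iff hC.isUnit _).1 h2)
    (measurableSet_Ioi.prod .univ) (polarIntegrand_eq_zero n p F t μ γ)

lemma integral_bayesIntegrand_eq {n : ℕ} {p : ℝ} {F : ℝ → ℝ} {t μ γ : ℝ} (hμ : 0 ≤ μ) :
    ∫ q, (wedge t μ).indicator (bayesIntegrand n p F γ) q =
      (Real.cos (Real.arctan γ))⁻¹ ^ (p - 1) *
        ∫ q in Ioi 0 ×ˢ univ, polarIntegrand n p F t μ γ q := by
  have hsub : polarCoord.target ⊆ Ioi (0 : ℝ) ×ˢ univ := by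
    rw [polarCoord_target]; exact prod_mono_right (subset_univ _)
  rw [← integral_comp_polarCoord_symm,
    setIntegral_congr_fun polarCoord.open_target.measurableSet
      fun q hq => polar_bayesIntegrand n p F t γ hμ hq, integral_const_mul,
    setIntegral_eq_of_subset_of_forall_sdiff_eq_zero (measurableSet_Ioi.prod .univ) hsub
      (polarIntegrand_eq_zero n p F t μ γ)]

/-- If the Bayes equation balances over the wedge with apex at the origin for the density `f`, the
corresponding integral over a shifted wedge is nonpositive for every rescaling of `f`. -/
lemma integral_bayesIntegrand_nonpos {n : ℕ} {p : ℝ} (hp : p ≤ 1) {f : ℝ → ℝ}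
    (hf : ∀ x > 0, 0 < f x) {t γ : ℝ} (htγ : 0 ≤ t + γ)
    (hint0 : Integrable ((wedge t 0).indicator (bayesIntegrand n p f γ)))
    (hzero : ∫ q, (wedge t 0).indicator (bayesIntegrand n p f γ) q = 0)
    {μ σ : ℝ} (hμ : 0 ≤ μ) (hσ : 0 < σ)
    (hint : Integrable ((wedge t μ).indicator (bayesIntegrand n p (fun x => f (x / σ ^ 2)) γ))) :
    ∫ q, (wedge t μ).indicator (bayesIntegrand n p (fun x => f (x / σ ^ 2)) γ) q ≤ 0 := by
  have hC : 0 < (Real.cos (Real.arctan γ))⁻¹ ^ (p - 1) :=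
    Real.rpow_pos_of_pos (inv_pos.2 (Real.cos_arctan_pos γ)) _
  have hP0 := integrableOn_polarIntegrand le_rfl hint0
  have hP := integrableOn_polarIntegrand hμ hint
  rw [integral_bayesIntegrand_eq le_rfl, mul_eq_zero, or_iff_right hC.ne'] at hzero
  rw [integral_bayesIntegrand_eq hμ]
  refine mul_nonpos_of_nonneg_of_nonpos hC.le ?_
  set α := Real.pi / 2 - Real.arctan t with hα
  set θ₀ := Real.pi / 2 + Real.arctan γ with hθ₀
  have hα0 : 0 < α := by have := Real.arctan_lt_pi_div_two t; linarith
  have hθ₀π : θ₀ < Real.pi := by have := Real.arctan_lt_pi_div_two γ; linarith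
  have hαθ : α ≤ θ₀ := by
    have h : Real.arctan (-t) ≤ Real.arctan γ := Real.arctan_mono (by linarith)
    rw [Real.arctan_neg] at h
    linarith
  have hαπ : α < Real.pi := by have := Real.neg_pi_div_two_lt_arctan t; linarith
  set k : ℝ → ℝ := fun r => r ^ (n + p) * f (r ^ 2) with hk
  set A := angularKernel n p α θ₀ with hA
  have heq0 : EqOn (polarIntegrand n p f t 0 γ) (fun q => k q.1 * A q.2) (Ioi 0 ×ˢ univ) := by
    rintro ⟨r, θ⟩ ⟨hr, -⟩
    have hr : 0 < r := hr
    simp only [polarIntegrand, ← hα, ← hθ₀, ← hA]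
    by_cases hm : θ ∈ Ioo α Real.pi
    · have h1 := hm.1
      have h2 := hm.2
      have : 0 < Real.sin (θ - α) := Real.sin_pos_of_pos_of_lt_pi (by linarith) (by linarith)
      rw [zero_mul, if_pos (mul_pos hr this), mul_comm]
    · simp [hA, angularKernel_of_notMem hm]
  have hmeas : (volume : Measure (ℝ × ℝ)).restrict (Ioi 0 ×ˢ univ) =
      (volume.restrict (Ioi 0)).prod volume := by
    rw [Measure.volume_eq_prod, ← Measure.prod_restrict, Measure.restrict_univ]
  have hkA : Integrable (fun q : ℝ × ℝ => k q.1 * A q.2)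
      ((volume.restrict (Ioi 0)).prod volume) := by
    rw [← hmeas]
    exact hP0.congr_fun heq0 (measurableSet_Ioi.prod .univ)
  rw [setIntegral_congr_fun (measurableSet_Ioi.prod .univ) heq0, hmeas,
    integral_prod_mul] at hzero
  have hkpos : ∀ r > 0, 0 < k r := fun r hr =>
    mul_pos (Real.rpow_pos_of_pos hr _) (hf _ (by positivity))
  have hAint : Integrable A := by
    have hne : NeZero ((volume : Measure ℝ).restrict (Ioi 0)) := ⟨by simp⟩
    obtain ⟨r, hr, hr0⟩ := (hkA.prod_right_ae.and
      (ae_restrict_mem measurableSet_Ioi)).exists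
    exact (integrable_const_mul_iff (hkpos r hr0).ne'.isUnit _).1 hr
  have hAne : ∃ᵐ θ, A θ ≠ 0 := by
    rw [frequently_ae_iff]
    have hsub : Ioo θ₀ Real.pi ⊆ {θ | A θ ≠ 0} := by
      rintro θ ⟨h1, h2⟩
      have h3 : 0 < Real.sin (θ - θ₀) := Real.sin_pos_of_pos_of_lt_pi (by linarith) (by linarith)
      have h4 : 0 < Real.sin θ := Real.sin_pos_of_pos_of_lt_pi (by linarith) h2
      change A θ ≠ 0
      rw [hA, angularKernel_of_mem ⟨by linarith, h2⟩, ← neg_sub θ, Real.sin_neg, signedPow_neg]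
      exact mul_ne_zero (neg_ne_zero.2 (signedPow_pos p h3).ne') (pow_pos h4 n).ne'
    refine (lt_of_lt_of_le ?_ (measure_mono hsub)).ne'
    rw [Real.volume_Ioo, ENNReal.ofReal_pos]
    linarith
  have hkint : IntegrableOn k (Ioi 0) := by
    obtain ⟨θ, hθ0, hθ⟩ := (hAne.and_eventually hkA.prod_left_ae).exists
    exact (integrable_mul_const_iff hθ0.isUnit _).1 hθ
  have hkpos' : 0 < ∫ r in Ioi 0, k r := by
    rw [setIntegral_pos_iff_support_of_nonneg_ae
      ((ae_restrict_mem measurableSet_Ioi).mono fun r hr => (hkpos r hr).le) hkint]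
    have hsub : Ioi 0 ⊆ Function.support k := fun r hr => (hkpos r hr).ne'
    rw [inter_eq_self_of_subset_right hsub]
    simp
  rw [mul_eq_zero, or_iff_right hkpos'.ne'] at hzero
  set K : ℝ → ℝ := fun r => r ^ (n + p) * f (r ^ 2 / σ ^ 2) with hK
  have hKpos : ∀ r > 0, 0 < K r := fun r hr =>
    mul_pos (Real.rpow_pos_of_pos hr _) (hf _ (by positivity))
  have hKint : IntegrableOn K (Ioi 0) := by
    have h1 := (integrableOn_Ioi_comp_mul_left_iff k 0 (inv_pos.2 hσ)).2 (by simpa using hkint)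
    refine IntegrableOn.congr_fun (h1.const_mul (σ ^ (n + p))) (fun r hr => ?_) measurableSet_Ioi
    have hr : 0 < r := hr
    simp only [hk, hK]
    rw [← mul_assoc, ← Real.mul_rpow hσ.le (by positivity), mul_inv_cancel_left₀ hσ.ne',
      mul_pow, inv_pow, inv_mul_eq_div]
  set m := μ * Real.cos (Real.arctan t) with hm
  set Ψ : ℝ → ℝ := fun S => ∫ r in Ioi 0, if m < r * S then K r else 0 with hΨ
  have hΨmono : Monotone Ψ := by
    have hi : ∀ S : ℝ, IntegrableOn (fun r => if m < r * S then K r else 0) (Ioi 0) := fun S =>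
      Integrable.indicator hKint (s := {r | m < r * S})
        (measurableSet_lt measurable_const (measurable_id.mul_const S))
    intro S S' hS
    refine setIntegral_mono_on (hi S) (hi S') measurableSet_Ioi fun r hr => ?_
    have hr : 0 < r := hr
    by_cases h : m < r * S
    · rw [if_pos h, if_pos (h.trans_le (by gcongr))]
    · rw [if_neg h]
      split_ifs
      exacts [(hKpos r hr).le, le_rfl]
  rw [IntegrableOn, hmeas] at hP
  have hinner : ∀ θ, ∫ r in Ioi 0, polarIntegrand n p (fun x => f (x / σ ^ 2)) t μ γ (r, θ) =
      A θ * Ψ (Real.sin (θ - α)) := fun θ => by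
    simp only [polarIntegrand, integral_const_mul, hΨ]
    rfl
  rw [hmeas, integral_prod_symm _ hP]
  have hAΨ := hP.integral_prod_right
  simp only [hinner] at hAΨ ⊢
  exact integral_angularKernel_mul_nonpos hp hα0 hαθ hθ₀π hAint hzero hΨmono hAΨ

lemma intervalIntegrable_signedPow_affine {p : ℝ} (hp : 0 < p) {s : ℝ} (hs : 0 < s) (u G : ℝ) :
    IntervalIntegrable (fun γ => signedPow p (u + γ * s)) volume 0 G := by
  have h := ((intervalIntegrable_signedPow hp u (u + G * s)).comp_add_left u).comp_mul_right
    (c := s)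
  simpa [hs.ne'] using h

lemma integral_signedPow_affine {p : ℝ} (hp : 0 < p) {s : ℝ} (hs : 0 < s) (u G : ℝ) :
    ∫ γ in (0 : ℝ)..G, signedPow p (u + γ * s) = (p * s)⁻¹ * (|u + G * s| ^ p - |u| ^ p) := by
  have h := integral_signedPow hp u (u + G * s)
  rw [intervalIntegral.integral_const_mul] at h
  simp only [mul_comm _ s] at h ⊢
  rw [intervalIntegral.integral_comp_add_mul _ hs.ne', ← h, mul_zero, add_zero, smul_eq_mul]
  field_simp

lemma integral_abs_signedPow_affine_le {p : ℝ} (hp : 0 < p) {s : ℝ} (hs : 0 < s) (u : ℝ)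
    {G : ℝ} (hG : 0 ≤ G) :
    ∫ γ in (0 : ℝ)..G, |signedPow p (u + γ * s)| ≤
      (p * s)⁻¹ * (|u + G * s| ^ p + |u| ^ p) := by
  have h := integral_abs_rpow_le hp u (u + G * s)
  have hle : ∫ x in u..(u + G * s), |signedPow p x| ≤ ∫ x in u..(u + G * s), |x| ^ (p - 1) :=
    intervalIntegral.integral_mono_on (by nlinarith) (intervalIntegrable_signedPow hp _ _).abs
      (intervalIntegrable_abs_rpow (by linarith) _ _) fun x _ => abs_signedPow_le p x
  rw [intervalIntegral.integral_const_mul] at h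
  simp only [mul_comm _ s] at h hle ⊢
  rw [intervalIntegral.integral_comp_add_mul (fun x => |signedPow p x|) hs.ne', mul_zero,
    add_zero, smul_eq_mul, mul_inv, mul_assoc]
  refine mul_le_mul_of_nonneg_left ?_ (inv_nonneg.2 hs.le)
  rw [inv_mul_eq_div, le_div_iff₀ hp]
  nlinarith

/-- An antitone function that satisfies the fundamental theorem of calculus for the (possibly
junk-valued) Bochner integral is continuous. -/
lemma continuous_of_antitone_of_integral {g g' : ℝ → ℝ} (hg : Antitone g)
    (hftc : ∀ a b : ℝ, g b - g a = ∫ y in a..b, g' y) : Continuous g := by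
  refine continuous_iff_continuousAt.2 fun c => ?_
  have hnhds : Icc (c - 1) (c + 1) ∈ nhds c := Icc_mem_nhds (by linarith) (by linarith)
  by_cases hi : IntervalIntegrable g' volume (c - 1) (c + 1)
  · have h := intervalIntegral.continuousOn_primitive_interval' hi left_mem_uIcc
    rw [uIcc_of_le (by linarith)] at h
    have h2 := (h.continuousAt hnhds).add_const (g (c - 1))
    refine h2.congr (Eventually.of_forall fun y => ?_)
    simp only [← hftc]; ring
  · have h := hftc (c - 1) (c + 1)
    rw [intervalIntegral.integral_undef hi] at h
    have hconst : ∀ y ∈ Icc (c - 1) (c + 1), g y = g (c - 1) := fun y hy =>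
      le_antisymm (hg hy.1) (by linarith [hg hy.2])
    refine (continuousAt_const (y := g (c - 1))).congr ?_
    filter_upwards [hnhds] with y hy using (hconst y hy).symm

lemma exists_level {g : ℝ → ℝ} (hg : Antitone g) (hcont : Continuous g)
    (hlim : Tendsto g atTop (nhds 0)) (hpos : ∀ y, 0 ≤ y + g y) {γ : ℝ} (hγ : 0 < γ) :
    ∃ t, g t = γ ∧ ∀ y, γ < g y ↔ y < t := by
  set S := {y | γ < g y} with hS
  have hne : S.Nonempty := ⟨-(γ + 1), by
    have := hpos (-(γ + 1)); change γ < g _; linarith⟩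
  have hbdd : BddAbove S := by
    obtain ⟨b, hb⟩ := (hlim.eventually (gt_mem_nhds hγ)).exists
    refine ⟨b, fun y hy => ?_⟩
    by_contra! h
    have hy : γ < g y := hy
    linarith [hg h.le]
  have hlt : ∀ y < sSup S, γ < g y := fun y hy => by
    obtain ⟨z, hz, hyz⟩ := exists_lt_of_lt_csSup hne hy
    exact lt_of_lt_of_le hz (hg hyz.le)
  have hge : γ ≤ g (sSup S) := by
    refine ge_of_tendsto (hcont.continuousWithinAt (s := Iio (sSup S)) (x := sSup S)) ?_
    filter_upwards [self_mem_nhdsWithin] with y hy using (hlt y hy).le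
  have hle : g (sSup S) ≤ γ := by
    refine le_of_tendsto (hcont.continuousWithinAt (s := Ioi (sSup S)) (x := sSup S)) ?_
    filter_upwards [self_mem_nhdsWithin] with y hy
    exact not_lt.1 fun h => (notMem_of_csSup_lt (s := S) hy hbdd) h
  refine ⟨sSup S, le_antisymm hle hge, fun y => ⟨fun h => ?_, hlt y⟩⟩
  refine lt_of_le_of_ne (le_csSup hbdd h) ?_
  rintro rfl
  linarith

/-- The integrand of the risk difference, disintegrated over the levels `γ` of the shrinkage
function `g`. -/
noncomputable def layerIntegrand (n : ℕ) (p : ℝ) (F g : ℝ → ℝ) (μ : ℝ) (z : ℝ × ℝ × ℝ) : ℝ :=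
  if z.1 < g (z.2.1 / z.2.2) then bayesIntegrand n p F z.1 (z.2.1 - μ, z.2.2) else 0

lemma setIntegral_Ioi_ite_lt {G : ℝ} (hG : 0 ≤ G) (φ : ℝ → ℝ) :
    ∫ γ in Ioi (0 : ℝ), (if γ < G then φ γ else 0) = ∫ γ in (0 : ℝ)..G, φ γ := by
  have h : (fun γ => if γ < G then φ γ else 0) = (Iio G).indicator φ := by
    funext γ; simp [indicator]
  rw [h, setIntegral_indicator measurableSet_Iio, Ioi_inter_Iio, intervalIntegral.integral_of_le hG,
    integral_Ioc_eq_integral_Ioo]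

section layer

variable {n : ℕ} {p : ℝ} {F g : ℝ → ℝ}

lemma integral_layerIntegrand (hn : 1 ≤ n) (hp : 0 < p) (hg : ∀ y, 0 ≤ g y) (μ x : ℝ) {s : ℝ}
    (hs : 0 < s) :
    ∫ γ in Ioi (0 : ℝ), layerIntegrand n p F g μ (γ, x, s) =
      p⁻¹ * (|x + g (x / s) * s - μ| ^ p - |x - μ| ^ p) *
        (s ^ (n - 1) * F ((x - μ) ^ 2 + s ^ 2)) := by
  obtain ⟨m, rfl⟩ := Nat.exists_eq_add_of_le' hn
  simp only [layerIntegrand, setIntegral_Ioi_ite_lt (hg _), bayesIntegrand,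
    intervalIntegral.integral_mul_const, integral_signedPow_affine hp hs, Nat.add_sub_cancel]
  rw [show x - μ + g (x / s) * s = x + g (x / s) * s - μ by ring]
  field_simp
  ring

lemma integral_abs_layerIntegrand_le (hn : 1 ≤ n) (hp : 0 < p) (hF : ∀ t > 0, 0 < F t)
    (hg : ∀ y, 0 ≤ g y) (μ x : ℝ) {s : ℝ} (hs : 0 < s) :
    ∫ γ in Ioi (0 : ℝ), ‖layerIntegrand n p F g μ (γ, x, s)‖ ≤
      p⁻¹ * (|x + g (x / s) * s - μ| ^ p + |x - μ| ^ p) *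
        (s ^ (n - 1) * F ((x - μ) ^ 2 + s ^ 2)) := by
  obtain ⟨m, rfl⟩ := Nat.exists_eq_add_of_le' hn
  have hF' : 0 < F ((x - μ) ^ 2 + s ^ 2) := hF _ (by positivity)
  have h1 := integral_abs_signedPow_affine_le hp hs (x - μ) (hg (x / s))
  simp only [layerIntegrand, apply_ite norm, norm_zero, setIntegral_Ioi_ite_lt (hg _),
    bayesIntegrand, norm_mul, Real.norm_eq_abs, intervalIntegral.integral_mul_const,
    Nat.add_sub_cancel, abs_of_pos hF', abs_of_pos (pow_pos hs (m + 1))]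
  refine (mul_le_mul_of_nonneg_right (mul_le_mul_of_nonneg_right h1 (by positivity))
    hF'.le).trans_eq ?_
  rw [show x - μ + g (x / s) * s = x + g (x / s) * s - μ by ring]
  field_simp
  ring

lemma integrable_layerIntegrand (hn : 1 ≤ n) (hp : 0 < p) (hF : ∀ t > 0, 0 < F t)
    (hFc : ContinuousOn F (Ioi 0)) (hg : ∀ y, 0 ≤ g y) (hganti : Antitone g) (μ : ℝ)
    (hint : IntegrableOn (fun q : ℝ × ℝ => (|q.1 + g (q.1 / q.2) * q.2 - μ| ^ p + |q.1 - μ| ^ p) *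
      (q.2 ^ (n - 1) * F ((q.1 - μ) ^ 2 + q.2 ^ 2))) (univ ×ˢ Ioi 0)) :
    Integrable (layerIntegrand n p F g μ)
      ((volume.restrict (Ioi 0)).prod (volume.restrict (univ ×ˢ Ioi 0))) := by
  have hms : MeasurableSet ((univ : Set ℝ) ×ˢ Ioi (0 : ℝ)) := .prod .univ measurableSet_Ioi
  have hmeas : AEStronglyMeasurable (layerIntegrand n p F g μ)
      ((volume.restrict (Ioi 0)).prod (volume.restrict (univ ×ˢ Ioi 0))) := by
    have h1 : MeasurableSet {z : ℝ × ℝ × ℝ | z.1 < g (z.2.1 / z.2.2)} :=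
      measurableSet_lt measurable_fst (hganti.measurable.comp (by fun_prop))
    have h2 : Measurable fun z : ℝ × ℝ × ℝ => signedPow p (z.2.1 - μ + z.1 * z.2.2) :=
      (measurable_signedPow p).comp (by fun_prop)
    have h3 : AEStronglyMeasurable (fun q : ℝ × ℝ => q.2 ^ n * F ((q.1 - μ) ^ 2 + q.2 ^ 2))
        (volume.restrict (univ ×ˢ Ioi 0)) := by
      refine ContinuousOn.aestronglyMeasurable ?_ hms
      refine ContinuousOn.mul (by fun_prop) (hFc.comp (by fun_prop) ?_)
      rintro ⟨x, s⟩ ⟨-, hs⟩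
      have hs : 0 < s := hs
      change 0 < (x - μ) ^ 2 + s ^ 2
      positivity
    refine ((h2.aestronglyMeasurable.mul (h3.comp_snd (μ := volume.restrict (Ioi 0)))).indicator
      h1).congr (Eventually.of_forall fun z => ?_)
    simp [indicator, layerIntegrand, bayesIntegrand, mul_assoc]
  rw [integrable_prod_iff' hmeas]
  constructor
  · filter_upwards [ae_restrict_mem hms] with ⟨x, s⟩ ⟨_, hs⟩
    have h1 := (intervalIntegrable_signedPow_affine hp hs (x - μ) (g (x / s))).mul_const
      (s ^ n * F ((x - μ) ^ 2 + s ^ 2))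
    rw [intervalIntegrable_iff_integrableOn_Ioo_of_le (hg _), ← Ioi_inter_Iio, inter_comm,
      ← integrable_indicator_iff (measurableSet_Iio.inter measurableSet_Ioi)] at h1
    rw [← IntegrableOn, ← integrable_indicator_iff measurableSet_Ioi]
    refine h1.congr (Eventually.of_forall fun γ => ?_)
    simp only [inter_comm (Iio _), ← indicator_indicator]
    congr 1
    funext y
    simp [indicator, layerIntegrand, bayesIntegrand, mul_assoc]
  · refine (hint.const_mul p⁻¹).mono' hmeas.norm.prod_swap.integral_prod_right' ?_
    filter_upwards [ae_restrict_mem hms] with ⟨x, s⟩ ⟨_, hs⟩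
    rw [Real.norm_of_nonneg (integral_nonneg fun _ => norm_nonneg _), ← mul_assoc]
    exact integral_abs_layerIntegrand_le hn hp hF hg μ x hs

lemma indicator_layerIntegrand {t γ : ℝ} (ht : ∀ y, γ < g y ↔ y < t) (μ : ℝ) :
    ((univ : Set ℝ) ×ˢ Ioi (0 : ℝ)).indicator (fun q => layerIntegrand n p F g μ (γ, q)) =
      fun q => (wedge t μ).indicator (bayesIntegrand n p F γ) (q - (μ, 0)) := by
  funext ⟨x, s⟩
  by_cases hs : 0 < s
  · rw [indicator_of_mem (by exact ⟨mem_univ _, hs⟩)]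
    simp only [layerIntegrand, ht, indicator, wedge, mem_ofPred_eq, Prod.mk_sub_mk, sub_zero,
      sub_add_cancel, hs, true_and, div_lt_iff₀ hs]
  · rw [indicator_of_notMem fun h => hs h.2, indicator_of_notMem]
    simp only [wedge, mem_ofPred_eq, Prod.mk_sub_mk, sub_zero, hs, false_and, not_false_eq_true]

end layer

lemma integral_wedge_eq {n : ℕ} {p : ℝ} {f : ℝ → ℝ} {t γ : ℝ}
    (hint : Integrable ((wedge t 0).indicator (bayesIntegrand n p f γ))) :
    ∫ q, (wedge t 0).indicator (bayesIntegrand n p f γ) q =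
      ∫ v in Ioi (0 : ℝ), ∫ u in Iio (v * t),
        signedPow p (u + γ * v) * v ^ n * f (u ^ 2 + v ^ 2) := by
  rw [Measure.volume_eq_prod] at hint ⊢
  rw [integral_prod_symm _ hint, ← integral_indicator measurableSet_Ioi]
  congr 1
  funext v
  by_cases hv : 0 < v
  · rw [indicator_of_mem (by exact hv), ← integral_indicator measurableSet_Iio]
    congr 1
    funext u
    simp [indicator, wedge, hv, bayesIntegrand, mul_comm v]
  · rw [indicator_of_notMem (by exact hv)]
    simp [indicator, wedge, hv]

/-- Theorem 3: under scale invariant `L^p` loss with `p ∈ (0,1)`, for any model density `f`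
satisfying the model assumption, the generalized Bayes estimator
`δ_{π0}(x,s) = x + g_{π0}(x/s) s` dominates the MRE estimator `δ₀(x,s) = x`
on `{μ ≥ 0, σ > 0}`. -/
theorem stmt2
    (n : ℕ) (hn : 1 ≤ n)
    (p : ℝ) (hp : p ∈ Set.Ioo (0 : ℝ) 1)
    -- the model assumption on f
    (f fd : ℝ → ℝ)
    (hf_pos : ∀ t > (0 : ℝ), 0 < f t)
    (hf_deriv : ∀ t > (0 : ℝ), HasDerivAt f (fd t) t)
    (hfd_neg : ∀ t > (0 : ℝ), fd t < 0)
    (hf_mlr : AntitoneOn (fun t => t * fd t / f t) (Ioi 0))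
    (hf_norm : (∫ s in Ioi (0 : ℝ), ∫ x : ℝ, s ^ (n - 1) * f (x ^ 2 + s ^ 2)) = 1)
    -- the L^p loss ρ(t) = |t|^p and its derivative ρ'(t) = p |t|^{p-1} sgn(t)
    (ρ ρd : ℝ → ℝ)
    (hρ_def : ∀ t : ℝ, ρ t = |t| ^ p)
    (hρd_def : ∀ t : ℝ, ρd t = p * |t| ^ (p - 1) * Real.sign t)
    -- g_{π0} : locally absolutely continuous, nonincreasing, with limit 0 at +∞,
    -- satisfying the defining Bayes equation and y + g_{π0}(y) ≥ 0
    (gpi gpi' : ℝ → ℝ)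
    (hgpi_ftc : ∀ a b : ℝ, gpi b - gpi a = ∫ y in a..b, gpi' y)
    (hgpi_anti : Antitone gpi)
    (hgpi_lim : Tendsto gpi atTop (nhds 0))
    (hgpi_eq : ∀ y : ℝ, (∫ v in Ioi (0 : ℝ), ∫ u in Iio (v * y),
        ρd (u + gpi y * v) * v ^ n * f (u ^ 2 + v ^ 2)) = 0)
    (hgpi_pos : ∀ y : ℝ, 0 ≤ y + gpi y)
    -- all risks below are finite
    (h_int0 : ∀ μ ≥ (0 : ℝ), ∀ σ > (0 : ℝ), IntegrableOn
      (fun q : ℝ × ℝ =>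
        ρ ((q.1 - μ) / σ) *
          (q.2 ^ (n - 1) / σ ^ (n + 1) * f (((q.1 - μ) ^ 2 + q.2 ^ 2) / σ ^ 2)))
      (univ ×ˢ Ioi 0))
    (h_intgpi : ∀ μ ≥ (0 : ℝ), ∀ σ > (0 : ℝ), IntegrableOn
      (fun q : ℝ × ℝ =>
        ρ ((q.1 + gpi (q.1 / q.2) * q.2 - μ) / σ) *
          (q.2 ^ (n - 1) / σ ^ (n + 1) * f (((q.1 - μ) ^ 2 + q.2 ^ 2) / σ ^ 2)))
      (univ ×ˢ Ioi 0)) :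
    ∀ μ ≥ (0 : ℝ), ∀ σ > (0 : ℝ),
      risk n f ρ (fun x s => x + gpi (x / s) * s) μ σ ≤
        risk n f ρ (fun x _s => x) μ σ := by
  obtain ⟨hp0, hp1⟩ := hp
  intro μ hμ σ hσ
  have hgnn : ∀ y, 0 ≤ gpi y := fun y => hgpi_anti.le_of_tendsto hgpi_lim y
  have hgcont := continuous_of_antitone_of_integral hgpi_anti hgpi_ftc
  have hfc : ContinuousOn f (Ioi 0) := fun t ht => (hf_deriv t ht).continuousAt.continuousWithinAt
  have hms : MeasurableSet ((univ : Set ℝ) ×ˢ Ioi (0 : ℝ)) := .prod .univ measurableSet_Ioi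
  have hloss : ∀ σ > (0 : ℝ), ∀ d w : ℝ, ρ (d / σ) * w = (σ ^ p)⁻¹ * (|d| ^ p * w) := by
    intro σ hσ d w
    rw [hρ_def, abs_div, abs_of_pos hσ, Real.div_rpow (abs_nonneg d) hσ.le]
    ring
  have hlayer : ∀ μ ≥ (0 : ℝ), ∀ σ > (0 : ℝ),
      Integrable (layerIntegrand n p (fun x => f (x / σ ^ 2)) gpi μ)
        ((volume.restrict (Ioi 0)).prod (volume.restrict (univ ×ˢ Ioi 0))) := by
    intro μ hμ σ hσ
    have hmaps : MapsTo (fun x : ℝ => x / σ ^ 2) (Ioi 0) (Ioi 0) := fun t ht => by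
      rw [mem_Ioi] at ht ⊢
      positivity
    refine integrable_layerIntegrand hn hp0 (fun t ht => hf_pos _ (by positivity))
      (hfc.comp (by fun_prop) hmaps) hgnn hgpi_anti μ ?_
    refine (((h_intgpi μ hμ σ hσ).add (h_int0 μ hμ σ hσ)).const_mul
      (σ ^ p * σ ^ (n + 1))).congr (Eventually.of_forall fun q => ?_)
    have hσp := Real.rpow_pos_of_pos hσ p
    simp only [Pi.add_apply, hloss σ hσ]
    field_simp
  have hslice : ∀ᵐ γ ∂(volume.restrict (Ioi (0 : ℝ))), ∫ q in univ ×ˢ Ioi (0 : ℝ),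
      layerIntegrand n p (fun x => f (x / σ ^ 2)) gpi μ (γ, q) ≤ 0 := by
    filter_upwards [(hlayer 0 le_rfl 1 one_pos).prod_right_ae, (hlayer μ hμ σ hσ).prod_right_ae,
      ae_restrict_mem measurableSet_Ioi] with γ h0 h1 hγ
    obtain ⟨t, rfl, ht⟩ := exists_level hgpi_anti hgcont hgpi_lim hgpi_pos hγ
    rw [← IntegrableOn, ← integrable_indicator_iff hms, indicator_layerIntegrand ht] at h0 h1
    rw [← integral_indicator hms, indicator_layerIntegrand ht, integral_sub_right_eq_self]
    have h0' := h0.comp_sub_right (-((0 : ℝ), (0 : ℝ)))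
    have h1' := h1.comp_sub_right (-(μ, (0 : ℝ)))
    simp only [one_pow, div_one, sub_neg_eq_add, add_sub_cancel_right] at h0' h1'
    refine integral_bayesIntegrand_nonpos hp1.le hf_pos (hgpi_pos t) h0' ?_ hμ hσ h1'
    rw [integral_wedge_eq h0']
    have h := hgpi_eq t
    have hfun : ∀ u v : ℝ, ρd (u + gpi t * v) * v ^ n * f (u ^ 2 + v ^ 2) =
        p * (signedPow p (u + gpi t * v) * v ^ n * f (u ^ 2 + v ^ 2)) := fun u v => by
      rw [hρd_def, signedPow]; ring
    simp only [hfun, integral_const_mul, mul_eq_zero, hp0.ne', false_or] at h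
    exact h
  have hrestrict : (volume : Measure (ℝ × ℝ)).restrict (univ ×ˢ Ioi 0) =
      volume.prod (volume.restrict (Ioi 0)) := by
    rw [Measure.volume_eq_prod, ← Measure.prod_restrict, Measure.restrict_univ]
  have hrisk : ∀ δ : ℝ → ℝ → ℝ, IntegrableOn (fun q : ℝ × ℝ => ρ ((δ q.1 q.2 - μ) / σ) *
      (q.2 ^ (n - 1) / σ ^ (n + 1) * f (((q.1 - μ) ^ 2 + q.2 ^ 2) / σ ^ 2))) (univ ×ˢ Ioi 0) →
      risk n f ρ δ μ σ = ∫ q in univ ×ˢ Ioi (0 : ℝ), ρ ((δ q.1 q.2 - μ) / σ) *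
        (q.2 ^ (n - 1) / σ ^ (n + 1) * f (((q.1 - μ) ^ 2 + q.2 ^ 2) / σ ^ 2)) := by
    intro δ hδ
    rw [IntegrableOn, hrestrict] at hδ
    rw [hrestrict, integral_prod_symm _ hδ, risk]
  have hσp := Real.rpow_pos_of_pos hσ p
  rw [← sub_nonpos, hrisk _ (h_intgpi μ hμ σ hσ), hrisk _ (h_int0 μ hμ σ hσ),
    ← integral_sub (h_intgpi μ hμ σ hσ) (h_int0 μ hμ σ hσ)]
  have hdiff : ∀ q ∈ (univ : Set ℝ) ×ˢ Ioi (0 : ℝ),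
      ρ ((q.1 + gpi (q.1 / q.2) * q.2 - μ) / σ) *
        (q.2 ^ (n - 1) / σ ^ (n + 1) * f (((q.1 - μ) ^ 2 + q.2 ^ 2) / σ ^ 2)) -
      ρ ((q.1 - μ) / σ) *
        (q.2 ^ (n - 1) / σ ^ (n + 1) * f (((q.1 - μ) ^ 2 + q.2 ^ 2) / σ ^ 2)) =
      p / (σ ^ p * σ ^ (n + 1)) *
        ∫ γ in Ioi (0 : ℝ), layerIntegrand n p (fun x => f (x / σ ^ 2)) gpi μ (γ, q) := by
    rintro ⟨x, s⟩ ⟨-, hs⟩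
    rw [integral_layerIntegrand hn hp0 hgnn μ x hs, hloss σ hσ, hloss σ hσ]
    field_simp
  rw [setIntegral_congr_fun hms hdiff, integral_const_mul]
  refine mul_nonpos_of_nonneg_of_nonpos (by positivity) ?_
  rw [← integral_prod_symm _ (hlayer μ hμ σ hσ), integral_prod _ (hlayer μ hμ σ hσ)]
  exact integral_nonpos_of_ae hslice
end

section
/- Let f₀ and h be functions from (0,∞) to (0,∞), each differentiable with negative derivative and with t ↦ t·f₀'(t)/f₀(t) and t ↦ t·h'(t)/h(t) nonincreasing on (0,∞). Define f(t) = ∫₀^∞ v f₀(tv) h(v) dv, assumed finite for every t > 0 and differentiable with f'(t) = ∫₀^∞ v² f₀'(tv) h(v) dv (differentiation under the integral sign being valid). Then f'(t) < 0 for all t > 0 and t ↦ t·f'(t)/f(t) is nonincreasing on (0,∞). -/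
open MeasureTheory Set

/-- The integral over a set of positive measure of a positive integrable function is positive. -/
theorem setIntegral_pos_of_pos {α : Type*} [MeasurableSpace α] {μ : Measure α} {s : Set α}
    {g : α → ℝ} (hs : MeasurableSet s) (hμ : 0 < μ s) (hg : IntegrableOn g s μ)
    (hpos : ∀ x ∈ s, 0 < g x) : 0 < ∫ x in s, g x ∂μ := by
  rw [setIntegral_pos_iff_support_of_nonneg_ae
    ((ae_restrict_mem hs).mono fun x hx => (hpos x hx).le) hg,
    inter_eq_right.2 fun x hx => Function.mem_support.2 (hpos x hx).ne']
  exact hμ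

/-- Two-weight Chebyshev inequality: a function `a` that varies oppositely to the ratio `q / p`
of two weights has a smaller weighted mean under `q` than under `p`. -/
theorem setIntegral_mul_le_of_antivary_weights {α : Type*} [MeasurableSpace α] {μ : Measure α}
    {s : Set α} {a p q : α → ℝ} (hs : MeasurableSet s)
    (hp : IntegrableOn p s μ) (hq : IntegrableOn q s μ)
    (hap : IntegrableOn (fun x => a x * p x) s μ) (haq : IntegrableOn (fun x => a x * q x) s μ)
    (hK : ∀ x ∈ s, ∀ y ∈ s, (a x - a y) * (q x * p y - p x * q y) ≤ 0) :
    (∫ x in s, a x * q x ∂μ) * (∫ x in s, p x ∂μ) ≤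
      (∫ x in s, a x * p x ∂μ) * (∫ x in s, q x ∂μ) := by
  have comb : ∀ c₁ c₂ c₃ c₄ : ℝ,
      ∫ x in s, (c₁ * (a x * q x) - c₂ * (a x * p x) - (c₃ * q x - c₄ * p x)) ∂μ =
        c₁ * (∫ x in s, a x * q x ∂μ) - c₂ * (∫ x in s, a x * p x ∂μ)
          - (c₃ * (∫ x in s, q x ∂μ) - c₄ * (∫ x in s, p x ∂μ)) := by
    intro c₁ c₂ c₃ c₄
    rw [integral_sub, integral_sub (haq.const_mul _) (hap.const_mul _),
      integral_sub (hq.const_mul _) (hp.const_mul _), integral_const_mul, integral_const_mul,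
      integral_const_mul, integral_const_mul]
    · exact (haq.const_mul _).sub (hap.const_mul _)
    · exact (hq.const_mul _).sub (hp.const_mul _)
  have inner : ∀ y ∈ s, p y * (∫ x in s, a x * q x ∂μ) - q y * (∫ x in s, a x * p x ∂μ)
      - (a y * p y * (∫ x in s, q x ∂μ) - a y * q y * (∫ x in s, p x ∂μ)) ≤ 0 := by
    intro y hy
    rw [← comb]
    refine setIntegral_nonpos hs fun x hx => ?_
    linarith [hK x hx y hy]
  have outer : ∫ y in s, ((∫ x in s, p x ∂μ) * (a y * q y) - (∫ x in s, q x ∂μ) * (a y * p y)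
      - ((∫ x in s, a x * p x ∂μ) * q y - (∫ x in s, a x * q x ∂μ) * p y)) ∂μ ≤ 0 :=
    setIntegral_nonpos hs fun y hy => by linarith [inner y hy]
  rw [comb] at outer
  linarith

/-- If `t ↦ t h'(t) / h(t)` is nonincreasing, then the scale family `u ↦ h (u / t)` has monotone
likelihood ratio. -/
theorem mul_le_mul_of_antitoneOn_logDeriv {h hd : ℝ → ℝ}
    (hpos : ∀ t > (0 : ℝ), 0 < h t) (hderiv : ∀ t > (0 : ℝ), HasDerivAt h (hd t) t)
    (hmlr : AntitoneOn (fun t => t * hd t / h t) (Ioi 0))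
    {r s w u : ℝ} (hr : 0 < r) (hrs : r ≤ s) (hw : 0 < w) (hwu : w ≤ u) :
    h (u / r) * h (w / s) ≤ h (u / s) * h (w / r) := by
  have hs : 0 < s := hr.trans_le hrs
  have hlog : ∀ t > 0, ∀ x > 0,
      HasDerivAt (fun x => Real.log (h (x / t))) (hd (x / t) * (1 / t) / h (x / t)) x := by
    intro t ht x hx
    have hxt : 0 < x / t := div_pos hx ht
    exact (HasDerivAt.comp x (hderiv _ hxt) ((hasDerivAt_id x).div_const t)).log (hpos _ hxt).ne'
  have hsub : ∀ x > 0, HasDerivAt (fun x => Real.log (h (x / s)) - Real.log (h (x / r)))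
      (hd (x / s) * (1 / s) / h (x / s) - hd (x / r) * (1 / r) / h (x / r)) x :=
    fun x hx => (hlog s hs x hx).sub (hlog r hr x hx)
  have hmono : MonotoneOn (fun x => Real.log (h (x / s)) - Real.log (h (x / r))) (Ioi 0) := by
    refine monotoneOn_of_hasDerivWithinAt_nonneg (convex_Ioi 0)
      (fun x hx => (hsub x hx).continuousAt.continuousWithinAt)
      (fun x hx => (hsub x (interior_subset hx)).hasDerivWithinAt) fun x hx => ?_
    replace hx : 0 < x := interior_subset hx
    have hxr := div_pos hx hr
    have hxs := div_pos hx hs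
    have key : x / r * hd (x / r) / h (x / r) ≤ x / s * hd (x / s) / h (x / s) :=
      hmlr hxs hxr (by gcongr)
    have hfac : hd (x / s) * (1 / s) / h (x / s) - hd (x / r) * (1 / r) / h (x / r)
        = (x / s * hd (x / s) / h (x / s) - x / r * hd (x / r) / h (x / r)) / x := by
      have := (hpos _ hxr).ne'
      have := (hpos _ hxs).ne'
      field_simp
    rw [hfac]
    exact div_nonneg (sub_nonneg.2 key) hx.le
  have hu : 0 < u := hw.trans_le hwu
  have hle := hmono hw hu hwu
  have hur := hpos _ (div_pos hu hr)
  have hus := hpos _ (div_pos hu hs)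
  have hwr := hpos _ (div_pos hw hr)
  have hws := hpos _ (div_pos hw hs)
  rw [← Real.log_le_log_iff (by positivity) (by positivity), Real.log_mul hur.ne' hws.ne',
    Real.log_mul hus.ne' hwr.ne']
  simp only at hle
  linarith

/-- Change of variables `u = t v` in an integral over `(0, ∞)`, where the substituted integrand
is known up to a constant factor. -/
theorem integrableOn_and_integral_Ioi_of_comp_mul {g k : ℝ → ℝ} {t c : ℝ} (ht : 0 < t)
    (hk : IntegrableOn k (Ioi 0)) (hg : ∀ v > 0, g (t * v) = c * k v) :
    IntegrableOn g (Ioi 0) ∧ ∫ u in Ioi (0 : ℝ), g u = t * c * ∫ v in Ioi (0 : ℝ), k v := by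
  constructor
  · have := (integrableOn_Ioi_comp_mul_left_iff g 0 ht).1
      ((integrableOn_congr_fun (fun v hv => hg v hv) measurableSet_Ioi).2 (hk.const_mul c))
    simpa using this
  · have := integral_comp_mul_left_Ioi g 0 ht
    rw [setIntegral_congr_fun measurableSet_Ioi (fun v hv => hg v hv), integral_const_mul,
      mul_zero, smul_eq_mul, eq_inv_mul_iff_mul_eq₀ ht.ne'] at this
    rw [← this, mul_assoc]


/-- Lemma 1: the model assumption (negative derivative and `t ↦ t f'(t)/f(t)` nonincreasing
on `(0,∞)`) is inherited by scale mixtures `f(t) = ∫₀^∞ v f₀(tv) h(v) dv`. -/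
theorem stmt4
    (f₀ f₀d h hd : ℝ → ℝ)
    -- f₀ maps (0,∞) to (0,∞) and satisfies the model assumption
    (hf₀_pos : ∀ t > (0 : ℝ), 0 < f₀ t)
    (hf₀_deriv : ∀ t > (0 : ℝ), HasDerivAt f₀ (f₀d t) t)
    (hf₀d_neg : ∀ t > (0 : ℝ), f₀d t < 0)
    (hf₀_mlr : AntitoneOn (fun t => t * f₀d t / f₀ t) (Ioi 0))
    -- h maps (0,∞) to (0,∞) and satisfies the model assumption
    (hh_pos : ∀ t > (0 : ℝ), 0 < h t)
    (hh_deriv : ∀ t > (0 : ℝ), HasDerivAt h (hd t) t)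
    (hhd_neg : ∀ t > (0 : ℝ), hd t < 0)
    (hh_mlr : AntitoneOn (fun t => t * hd t / h t) (Ioi 0))
    -- the mixture f and its derivative fd, assumed finite (integrable) and
    -- with differentiation under the integral sign valid
    (f fd : ℝ → ℝ)
    (hf_def : ∀ t > (0 : ℝ), f t = ∫ v in Ioi (0 : ℝ), v * f₀ (t * v) * h v)
    (hf_int : ∀ t > (0 : ℝ), IntegrableOn (fun v => v * f₀ (t * v) * h v) (Ioi 0))
    (hfd_def : ∀ t > (0 : ℝ), fd t = ∫ v in Ioi (0 : ℝ), v ^ 2 * f₀d (t * v) * h v)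
    (hfd_int : ∀ t > (0 : ℝ), IntegrableOn (fun v => v ^ 2 * f₀d (t * v) * h v) (Ioi 0))
    (hf_deriv : ∀ t > (0 : ℝ), HasDerivAt f (fd t) t) :
    (∀ t > (0 : ℝ), fd t < 0) ∧ AntitoneOn (fun t => t * fd t / f t) (Ioi 0) := by

  have hf_pos : ∀ t > (0 : ℝ), 0 < f t := fun t ht => by
    rw [hf_def t ht]
    exact setIntegral_pos_of_pos measurableSet_Ioi (by simp) (hf_int t ht) fun v hv =>
      mul_pos (mul_pos hv (hf₀_pos _ (mul_pos ht hv))) (hh_pos v hv)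
  refine ⟨fun t ht => ?_, fun r (hr : 0 < r) s (hs : 0 < s) hrs => ?_⟩
  · rw [hfd_def t ht, ← neg_pos, ← integral_neg]
    refine setIntegral_pos_of_pos measurableSet_Ioi (by simp) (hfd_int t ht).neg fun v hv => ?_
    exact neg_pos.2 (mul_neg_of_neg_of_pos (mul_neg_of_pos_of_neg (pow_pos hv 2)
      (hf₀d_neg _ (mul_pos ht hv))) (hh_pos v hv))
  have weight : ∀ t > (0 : ℝ), IntegrableOn (fun u => u * f₀ u * h (u / t)) (Ioi 0) ∧
      ∫ u in Ioi (0 : ℝ), u * f₀ u * h (u / t) = t * t * f t := fun t ht => by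
    rw [hf_def t ht]
    refine integrableOn_and_integral_Ioi_of_comp_mul ht (hf_int t ht) fun v _ => ?_
    rw [mul_div_cancel_left₀ v ht.ne']
    ring
  have weighted : ∀ t > (0 : ℝ),
      IntegrableOn (fun u => u * f₀d u / f₀ u * (u * f₀ u * h (u / t))) (Ioi 0) ∧
      ∫ u in Ioi (0 : ℝ), u * f₀d u / f₀ u * (u * f₀ u * h (u / t)) = t * t ^ 2 * fd t :=
    fun t ht => by
      rw [hfd_def t ht]
      refine integrableOn_and_integral_Ioi_of_comp_mul ht (hfd_int t ht) fun v hv => ?_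
      have := (hf₀_pos _ (mul_pos ht hv)).ne'
      rw [mul_div_cancel_left₀ v ht.ne']
      field_simp
  have mlr : ∀ x > 0, ∀ y > 0, y ≤ x →
      (x * f₀d x / f₀ x - y * f₀d y / f₀ y) * (x * f₀ x * h (x / s) * (y * f₀ y * h (y / r))
        - x * f₀ x * h (x / r) * (y * f₀ y * h (y / s))) ≤ 0 := fun x hx y hy hyx => by
    have ha : x * f₀d x / f₀ x ≤ y * f₀d y / f₀ y := hf₀_mlr hy hx hyx
    have hh := mul_le_mul_of_antitoneOn_logDeriv hh_pos hh_deriv hh_mlr hr hrs hy hyx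
    have hc : 0 ≤ x * f₀ x * (y * f₀ y) :=
      (mul_pos (mul_pos hx (hf₀_pos x hx)) (mul_pos hy (hf₀_pos y hy))).le
    refine mul_nonpos_of_nonpos_of_nonneg (sub_nonpos.2 ha) ?_
    linarith [mul_le_mul_of_nonneg_left hh hc]
  have key := setIntegral_mul_le_of_antivary_weights measurableSet_Ioi (weight r hr).1
    (weight s hs).1 (weighted r hr).1 (weighted s hs).1 fun x hx y hy => by
      rcases le_total y x with hyx | hxy
      · exact mlr x hx y hy hyx
      · linarith [mlr y hy x hx hxy]
  rw [(weight r hr).2, (weight s hs).2, (weighted r hr).2, (weighted s hs).2] at key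
  simp only
  rw [div_le_div_iff₀ (hf_pos s hs) (hf_pos r hr)]
  have hc : 0 < r ^ 2 * s ^ 2 := by positivity
  refine le_of_mul_le_mul_left ?_ hc
  linarith
end

section
/- Let p > 0, c₁ > 0, c₂ > 0, let q ∈ ℝ, let y, h ∈ ℝ, and let f : (0,∞) → [0,∞) be measurable. Then, as an identity of integrals of nonnegative functions (both sides possibly infinite), ∫₀^∞∫_{-∞}^{vy} ρ_{c₁,c₂}(u + hv) v^{q-1} f(u²+v²) du dv = (1/2) · (∫₀^∞ x^{(q+p-1)/2} f(x) dx) · (∫_{-∞}^{y} ρ_{c₁,c₂}(t+h) (1+t²)^{-(q+p+1)/2} dt). -/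
open MeasureTheory Set
open scoped ENNReal

/-- The asymmetric `L^p` loss `ρ_{c₁,c₂}(t) = c₁|t|^p` for `t < 0` and `c₂ t^p` for `t ≥ 0`. -/
noncomputable def rhoAsym (p c₁ c₂ : ℝ) (t : ℝ) : ℝ :=
  if t < 0 then c₁ * |t| ^ p else c₂ * t ^ p

theorem rhoAsym_nonneg {p c₁ c₂ : ℝ} (hc₁ : 0 ≤ c₁) (hc₂ : 0 ≤ c₂) (t : ℝ) :
    0 ≤ rhoAsym p c₁ c₂ t := by
  unfold rhoAsym
  split_ifs with ht
  · positivity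
  · exact mul_nonneg hc₂ (Real.rpow_nonneg (not_lt.mp ht) p)

theorem rhoAsym_mul (p c₁ c₂ : ℝ) {v : ℝ} (hv : 0 < v) (t : ℝ) :
    rhoAsym p c₁ c₂ (v * t) = v ^ p * rhoAsym p c₁ c₂ t := by
  unfold rhoAsym
  have hneg : v * t < 0 ↔ t < 0 := by simp [mul_neg_iff, hv, hv.not_gt]
  simp only [hneg]
  split_ifs with ht
  · rw [abs_mul, abs_of_pos hv, Real.mul_rpow hv.le (abs_nonneg t)]
    ring
  · rw [Real.mul_rpow hv.le (not_lt.mp ht)]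
    ring

theorem measurable_rhoAsym (p c₁ c₂ : ℝ) : Measurable (rhoAsym p c₁ c₂) := by
  unfold rhoAsym
  exact Measurable.ite measurableSet_Iio (by fun_prop) (by fun_prop)

theorem lintegral_Iio_mul_eq {v : ℝ} (hv : 0 < v) (y : ℝ) (F : ℝ → ℝ≥0∞) :
    ∫⁻ u in Iio (v * y), F u = ∫⁻ t in Iio y, ENNReal.ofReal v * F (v * t) := by
  have himage : (fun t => v * t) '' Iio y = Iio (v * y) := image_mul_left_Iio hv y
  have hderiv : ∀ t ∈ Iio y, HasDerivWithinAt (fun t => v * t) v (Iio y) t := fun t _ => by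
    simpa using ((hasDerivAt_id t).const_mul v).hasDerivWithinAt
  rw [← himage, lintegral_image_eq_lintegral_abs_deriv_mul measurableSet_Iio hderiv
    (mul_right_injective₀ hv.ne').injOn, abs_of_pos hv]

theorem lintegral_Ioi_sq_mul_eq {s : ℝ} (hs : 0 < s) (G : ℝ → ℝ≥0∞) :
    ∫⁻ x in Ioi (0 : ℝ), G x =
      ∫⁻ v in Ioi (0 : ℝ), ENNReal.ofReal (2 * v * s) * G (v ^ 2 * s) := by
  have himage : (fun v : ℝ => v ^ 2 * s) '' Ioi 0 = Ioi 0 := by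
    ext x
    simp only [mem_image, mem_Ioi]
    constructor
    · rintro ⟨v, hv, rfl⟩
      positivity
    · intro hx
      refine ⟨√(x / s), by positivity, ?_⟩
      rw [Real.sq_sqrt (by positivity)]
      field_simp
  have hderiv : ∀ v ∈ Ioi (0 : ℝ),
      HasDerivWithinAt (fun v : ℝ => v ^ 2 * s) (2 * v * s) (Ioi 0) v := fun v _ => by
    simpa using (((hasDerivAt_id v).pow 2).mul_const s).hasDerivWithinAt
  have hinj : InjOn (fun v : ℝ => v ^ 2 * s) (Ioi 0) := fun a ha b hb hab =>
    (pow_left_inj₀ (mem_Ioi.mp ha).le (mem_Ioi.mp hb).le two_ne_zero).mp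
      (mul_right_cancel₀ hs.ne' hab)
  conv_lhs => rw [← himage]
  rw [lintegral_image_eq_lintegral_abs_deriv_mul measurableSet_Ioi hderiv hinj]
  refine setLIntegral_congr_fun measurableSet_Ioi fun v hv => ?_
  have hv : 0 < v := hv
  simp only [abs_of_pos (show 0 < 2 * v * s by positivity)]

theorem lintegral_rpow_mul_comp_sq_mul {s : ℝ} (hs : 0 < s) (r : ℝ) (f : ℝ → ℝ) :
    ∫⁻ v in Ioi (0 : ℝ), ENNReal.ofReal (v ^ r * f (v ^ 2 * s)) =
      ENNReal.ofReal (1 / 2 * s ^ (-((r + 1) / 2))) *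
        ∫⁻ x in Ioi (0 : ℝ), ENNReal.ofReal (x ^ ((r - 1) / 2) * f x) := by
  rw [lintegral_Ioi_sq_mul_eq hs (fun x => ENNReal.ofReal (x ^ ((r - 1) / 2) * f x)),
    ← lintegral_const_mul' _ _ ENNReal.ofReal_ne_top]
  refine setLIntegral_congr_fun measurableSet_Ioi fun v hv => ?_
  have hv : 0 < v := hv
  rw [← ENNReal.ofReal_mul (by positivity), ← ENNReal.ofReal_mul (by positivity)]
  congr 1
  have hvr : (v ^ 2 * s) ^ ((r - 1) / 2) = v ^ (r - 1) * s ^ ((r - 1) / 2) := by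
    rw [Real.mul_rpow (by positivity) hs.le, ← Real.rpow_natCast_mul hv.le]
    congr 2
    push_cast
    ring
  have hvv : v ^ (r - 1) * v = v ^ r := by
    rw [Real.rpow_sub_one hv.ne']
    field_simp
  have hss : s ^ (-((r + 1) / 2)) * s * s ^ ((r - 1) / 2) = 1 := by
    rw [← Real.rpow_add_one hs.ne', ← Real.rpow_add hs]
    ring_nf
    exact Real.rpow_zero s
  rw [hvr]
  linear_combination (-v ^ r * f (v ^ 2 * s)) * hss -
    (s ^ (-((r + 1) / 2)) * s * s ^ ((r - 1) / 2)) * f (v ^ 2 * s) * hvv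

/-- The factorization identity obtained from the change of variables
`(u,v) ↦ (t,x) = (u/v, u²+v²)`, as an identity of integrals of nonnegative functions
(both sides possibly infinite). -/
theorem stmt6
    (p c₁ c₂ : ℝ) (hp : 0 < p) (hc₁ : 0 < c₁) (hc₂ : 0 < c₂)
    (q : ℝ) (y h : ℝ)
    (f : ℝ → ℝ) (hf_meas : Measurable f) (hf_nonneg : ∀ t > (0 : ℝ), 0 ≤ f t) :
    (∫⁻ v in Ioi (0 : ℝ), ∫⁻ u in Iio (v * y),
        ENNReal.ofReal (rhoAsym p c₁ c₂ (u + h * v) * (v ^ (q - 1) * f (u ^ 2 + v ^ 2)))) =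
      ENNReal.ofReal ((1 : ℝ) / 2) *
        (∫⁻ x in Ioi (0 : ℝ), ENNReal.ofReal (x ^ ((q + p - 1) / 2) * f x)) *
        (∫⁻ t in Iio y,
          ENNReal.ofReal (rhoAsym p c₁ c₂ (t + h) * (1 + t ^ 2) ^ (-((q + p + 1) / 2)))) := by
  have hρ := rhoAsym_nonneg (p := p) hc₁.le hc₂.le
  have hρ_meas := measurable_rhoAsym p c₁ c₂
  have hscale : ∀ v ∈ Ioi (0 : ℝ),
      ∫⁻ u in Iio (v * y),
          ENNReal.ofReal (rhoAsym p c₁ c₂ (u + h * v) * (v ^ (q - 1) * f (u ^ 2 + v ^ 2))) =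
        ∫⁻ t in Iio y, ENNReal.ofReal (rhoAsym p c₁ c₂ (t + h)) *
          ENNReal.ofReal (v ^ (q + p) * f (v ^ 2 * (1 + t ^ 2))) := by
    intro v hv
    have hv : 0 < v := hv
    rw [lintegral_Iio_mul_eq hv]
    refine lintegral_congr fun t => ?_
    rw [← ENNReal.ofReal_mul hv.le, ← ENNReal.ofReal_mul (hρ _),
      show v * t + h * v = v * (t + h) by ring, rhoAsym_mul p c₁ c₂ hv,
      show (v * t) ^ 2 + v ^ 2 = v ^ 2 * (1 + t ^ 2) by ring,
      Real.rpow_add hv, Real.rpow_sub_one hv.ne']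
    congr 1
    field_simp
  rw [setLIntegral_congr_fun measurableSet_Ioi hscale,
    lintegral_lintegral_swap (by fun_prop), mul_right_comm,
    ← lintegral_const_mul' _ _ ENNReal.ofReal_ne_top, ← lintegral_mul_const _ (by fun_prop)]
  refine lintegral_congr fun t => ?_
  rw [lintegral_const_mul' _ _ ENNReal.ofReal_ne_top,
    lintegral_rpow_mul_comp_sq_mul (by positivity), ← mul_assoc,
    ← ENNReal.ofReal_mul (hρ _), ← ENNReal.ofReal_mul (by norm_num)]
  congr 2
  ring
end

section
/- Let f : (0,∞) → (0,∞) be measurable and positive, let ρ be a strictly bowl-shaped loss, let c₀ ∈ ℝ, m > 0, y ∈ ℝ, and suppose z ∈ ℝ satisfies y + c₀ + z ≥ 0 and B_m(y, z) = 0, with all integrals involved absolutely convergent. Then for every a > 0, B_m(y + a, z) > 0. -/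
open MeasureTheory Set

/-- `B_m(w,z) = ∫₀^∞∫_{-∞}^{vw} ρ'(u + c₀v + zv) v^m f(u²+v²) du dv`. -/
noncomputable def Bm (f ρd : ℝ → ℝ) (c₀ m w z : ℝ) : ℝ :=
  ∫ v in Ioi (0 : ℝ), ∫ u in Iio (v * w),
    ρd (u + c₀ * v + z * v) * v ^ m * f (u ^ 2 + v ^ 2)

/-- An integrable function that is positive almost everywhere for a nonzero measure has positive
integral. -/
theorem integral_pos_of_ae_pos {α : Type*} [MeasurableSpace α] {μ : Measure α} (hμ : μ ≠ 0)
    {h : α → ℝ} (hi : Integrable h μ) (hpos : ∀ᵐ x ∂μ, 0 < h x) : 0 < ∫ x, h x ∂μ := by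
  have hnn : 0 ≤ᵐ[μ] h := hpos.mono fun x hx => hx.le
  refine (integral_nonneg_of_ae hnn).lt_of_ne fun h0 => hμ ?_
  have hz := (integral_eq_zero_iff_of_nonneg_ae hnn hi).1 h0.symm
  have : ∀ᵐ x ∂μ, False := by
    filter_upwards [hpos, hz] with x h1 h2
    rw [h2] at h1
    exact lt_irrefl _ h1
  exact ae_eq_bot.1 (Filter.eventually_false_iff_eq_bot.1 this)

/-- Slices of a function integrable on the wedge `{0 < v, u < v w}`: almost every slice is
integrable, and the slice integrals are integrable. -/
theorem integrableOn_wedge_slices {g : ℝ × ℝ → ℝ} {w : ℝ}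
    (hg : IntegrableOn g {p : ℝ × ℝ | 0 < p.2 ∧ p.1 < p.2 * w}) :
    (∀ᵐ v ∂volume.restrict (Ioi (0 : ℝ)), IntegrableOn (fun u => g (u, v)) (Iio (v * w))) ∧
      IntegrableOn (fun v => ∫ u in Iio (v * w), g (u, v)) (Ioi 0) := by
  have hS : MeasurableSet {p : ℝ × ℝ | 0 < p.2 ∧ p.1 < p.2 * w} :=
    (measurableSet_lt measurable_const measurable_snd).inter
      (measurableSet_lt measurable_fst (measurable_snd.mul_const w))
  have hi := (integrable_indicator_iff hS).2 hg
  rw [Measure.volume_eq_prod] at hi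
  have hslice : ∀ v ∈ Ioi (0 : ℝ),
      (fun u => {p : ℝ × ℝ | 0 < p.2 ∧ p.1 < p.2 * w}.indicator g (u, v)) =
        (Iio (v * w)).indicator fun u => g (u, v) := by
    intro v hv
    funext u
    simp only [indicator, mem_ofPred_eq, mem_Iio, mem_Ioi.1 hv, true_and]
  constructor
  · filter_upwards [ae_restrict_of_ae hi.prod_left_ae, ae_restrict_mem measurableSet_Ioi]
      with v h1 hv
    rw [hslice v hv] at h1
    exact (integrable_indicator_iff measurableSet_Iio).1 h1
  · refine IntegrableOn.congr_fun hi.integral_prod_right.integrableOn (fun v hv => ?_)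
      measurableSet_Ioi
    simp only [hslice v hv]
    exact integral_indicator measurableSet_Iio

/-- Lemma 4(a): if `B_m(y,z) = 0` and `y + c₀ + z ≥ 0`, then `B_m(y+a, z) > 0`
for every `a > 0`. -/
theorem stmt8
    (f : ℝ → ℝ) (hf_meas : Measurable f) (hf_pos : ∀ t > (0 : ℝ), 0 < f t)
    (ρ ρd : ℝ → ℝ) (hρd_meas : Measurable ρd)
    (hρ0 : ρ 0 = 0) (hρ_nonneg : ∀ t, 0 ≤ ρ t)
    (hρd_neg : ∀ t < (0 : ℝ), ρd t < 0) (hρd_pos : ∀ t > (0 : ℝ), 0 < ρd t)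
    (hρ_ftc : ∀ a b : ℝ, ρ b - ρ a = ∫ t in a..b, ρd t)
    (c₀ : ℝ) (m : ℝ) (hm : 0 < m) (y z : ℝ)
    (hz_nonneg : 0 ≤ y + c₀ + z)
    (hB0 : Bm f ρd c₀ m y z = 0)
    -- absolute convergence of all the integrals involved
    (h_int : ∀ w : ℝ, IntegrableOn
      (fun pr : ℝ × ℝ => ρd (pr.1 + c₀ * pr.2 + z * pr.2) * pr.2 ^ m * f (pr.1 ^ 2 + pr.2 ^ 2))
      {pr : ℝ × ℝ | 0 < pr.2 ∧ pr.1 < pr.2 * w}) :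
    ∀ a > (0 : ℝ), 0 < Bm f ρd c₀ m (y + a) z := by
  intro a ha
  obtain ⟨hs, hF⟩ := integrableOn_wedge_slices (h_int (y + a))
  obtain ⟨-, hF'⟩ := integrableOn_wedge_slices (h_int y)
  rw [← hB0, ← sub_pos, Bm, Bm, ← integral_sub hF hF']
  refine integral_pos_of_ae_pos ?_ (hF.sub hF') ?_
  · simp [Measure.restrict_eq_zero]
  filter_upwards [hs, ae_restrict_mem measurableSet_Ioi] with v hv hv0
  rw [mem_Ioi] at hv0
  have hlt : v * y < v * (y + a) := by nlinarith
  have hsub : Iio (v * y) ⊆ Iio (v * (y + a)) := Iio_subset_Iio hlt.le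
  rw [← setIntegral_sdiff measurableSet_Iio hv hsub, Iio_sdiff_Iio,
    integral_Ico_eq_integral_Ioo]
  refine integral_pos_of_ae_pos ?_ (hv.mono_set fun u hu => hu.2) ?_
  · simpa [Measure.restrict_eq_zero] using hlt
  filter_upwards [ae_restrict_mem measurableSet_Ioo] with u hu
  have h1 : 0 < u + c₀ * v + z * v := by
    have := hu.1
    nlinarith [mul_nonneg hv0.le hz_nonneg]
  have h2 : 0 < u ^ 2 + v ^ 2 := by positivity
  exact mul_pos (mul_pos (hρd_pos _ h1) (Real.rpow_pos_of_pos hv0 m)) (hf_pos _ h2)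
end

section
/- Let f : (0,∞) → (0,∞) be positive, let ρ be a strictly bowl-shaped and convex loss (so that ρ' is nondecreasing), let c₀ ∈ ℝ and m > 0, and assume all integrals defining B_m are absolutely convergent. If g : ℝ → ℝ satisfies B_m(y, g(y)) = 0 and y + c₀ + g(y) ≥ 0 for every y ∈ ℝ, then g is strictly decreasing on ℝ. -/
open MeasureTheory Set

/-- The graph `{(u, v) | u = v * y}` of a linear function is a null set of the plane. -/
lemma volume_setOf_fst_eq_snd_mul (y : ℝ) :
    volume {pr : ℝ × ℝ | pr.1 = pr.2 * y} = 0 := by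
  have hmeas : MeasurableSet {pr : ℝ × ℝ | pr.1 = pr.2 * y} :=
    measurableSet_eq_fun measurable_fst (measurable_snd.mul_const y)
  rw [Measure.volume_eq_prod, Measure.prod_apply_symm hmeas]
  simp [preimage]

lemma measurableSet_wedge (w : ℝ) :
    MeasurableSet {pr : ℝ × ℝ | 0 < pr.2 ∧ pr.1 < pr.2 * w} :=
  (measurableSet_lt measurable_const measurable_snd).inter
    (measurableSet_lt measurable_fst (measurable_snd.mul_const w))

/-- `B_m(w,z)` as an integral over a planar region. -/
lemma Bm_eq_setIntegral (f ρd : ℝ → ℝ) (c₀ m w z : ℝ)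
    (h_int : IntegrableOn
      (fun pr : ℝ × ℝ => ρd (pr.1 + c₀ * pr.2 + z * pr.2) * pr.2 ^ m * f (pr.1 ^ 2 + pr.2 ^ 2))
      {pr : ℝ × ℝ | 0 < pr.2 ∧ pr.1 < pr.2 * w}) :
    Bm f ρd c₀ m w z = ∫ pr in {pr : ℝ × ℝ | 0 < pr.2 ∧ pr.1 < pr.2 * w},
      ρd (pr.1 + c₀ * pr.2 + z * pr.2) * pr.2 ^ m * f (pr.1 ^ 2 + pr.2 ^ 2) := by
  have hS := measurableSet_wedge w
  rw [← integrable_indicator_iff hS, Measure.volume_eq_prod] at h_int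
  rw [← integral_indicator hS, Measure.volume_eq_prod, integral_prod_symm _ h_int, Bm,
    ← integral_indicator measurableSet_Ioi]
  refine integral_congr_ae (.of_forall fun v => ?_)
  by_cases hv : 0 < v
  · simp only [indicator, mem_Ioi, hv, if_true, mem_ofPred_eq, true_and]
    rw [← integral_indicator measurableSet_Iio]
    rfl
  · simp [indicator, hv]

/-- For a nondecreasing `ρ'`, `B_m(w, z)` is nondecreasing in `z`. -/
lemma Bm_mono_right (f ρd : ℝ → ℝ) (hf_pos : ∀ t > (0 : ℝ), 0 < f t) (hρd_mono : Monotone ρd)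
    (c₀ m w : ℝ)
    (h_int : ∀ z : ℝ, IntegrableOn
      (fun pr : ℝ × ℝ => ρd (pr.1 + c₀ * pr.2 + z * pr.2) * pr.2 ^ m * f (pr.1 ^ 2 + pr.2 ^ 2))
      {pr : ℝ × ℝ | 0 < pr.2 ∧ pr.1 < pr.2 * w}) :
    Monotone (Bm f ρd c₀ m w) := by
  intro z z' hz
  rw [Bm_eq_setIntegral f ρd c₀ m w z (h_int z), Bm_eq_setIntegral f ρd c₀ m w z' (h_int z')]
  refine setIntegral_mono_on (h_int z) (h_int z') (measurableSet_wedge w) ?_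
  rintro ⟨u, v⟩ ⟨hv, -⟩
  dsimp only at hv ⊢
  have hf := (hf_pos (u ^ 2 + v ^ 2) (by positivity)).le
  gcongr
  exact hρd_mono (by gcongr)

/-- If `y + c₀ + z ≥ 0`, then `B_m(·, z)` takes strictly larger values to the right of `y`. -/
lemma Bm_lt_Bm_left (f ρd : ℝ → ℝ) (hf_pos : ∀ t > (0 : ℝ), 0 < f t)
    (hρd_pos : ∀ t > (0 : ℝ), 0 < ρd t) (c₀ m z : ℝ)
    (h_int : ∀ w : ℝ, IntegrableOn
      (fun pr : ℝ × ℝ => ρd (pr.1 + c₀ * pr.2 + z * pr.2) * pr.2 ^ m * f (pr.1 ^ 2 + pr.2 ^ 2))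
      {pr : ℝ × ℝ | 0 < pr.2 ∧ pr.1 < pr.2 * w})
    {y y' : ℝ} (hy : y < y') (hz : 0 ≤ y + c₀ + z) :
    Bm f ρd c₀ m y z < Bm f ρd c₀ m y' z := by
  rw [Bm_eq_setIntegral f ρd c₀ m y z (h_int y), Bm_eq_setIntegral f ρd c₀ m y' z (h_int y')]
  set F : ℝ × ℝ → ℝ := fun pr =>
    ρd (pr.1 + c₀ * pr.2 + z * pr.2) * pr.2 ^ m * f (pr.1 ^ 2 + pr.2 ^ 2)
  set S : ℝ → Set (ℝ × ℝ) := fun w => {pr | 0 < pr.2 ∧ pr.1 < pr.2 * w}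
  set T : Set (ℝ × ℝ) := {pr | 0 < pr.2 ∧ pr.2 * y < pr.1 ∧ pr.1 < pr.2 * y'}
  have hT_open : IsOpen T :=
    (isOpen_lt continuous_const continuous_snd).inter
      ((isOpen_lt (by fun_prop) continuous_fst).inter (isOpen_lt continuous_fst (by fun_prop)))
  have hT_int : IntegrableOn F T := (h_int y').mono_set fun pr h => ⟨h.1, h.2.2⟩
  have hF_pos : ∀ pr ∈ T, 0 < F pr := by
    rintro ⟨u, v⟩ ⟨hv, hu, -⟩
    dsimp only at hv hu
    have hf := hf_pos (u ^ 2 + v ^ 2) (by positivity)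
    have hρ := hρd_pos (u + c₀ * v + z * v) (by nlinarith [mul_nonneg hv.le hz])
    dsimp only [F]
    positivity
  have hdisj : Disjoint (S y) T :=
    Set.disjoint_left.2 fun pr h h' => lt_asymm h.2 h'.2.1
  have hunion : (S y' : Set (ℝ × ℝ)) =ᵐ[volume] (S y ∪ T : Set (ℝ × ℝ)) := by
    have hline : ∀ᵐ pr : ℝ × ℝ, pr.1 ≠ pr.2 * y := by
      simpa [ae_iff] using volume_setOf_fst_eq_snd_mul y
    filter_upwards [hline] with pr hpr
    refine propext ⟨fun h => ?_, ?_⟩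
    · rcases lt_or_gt_of_ne hpr with hlt | hgt
      · exact Or.inl ⟨h.1, hlt⟩
      · exact Or.inr ⟨h.1, hgt, h.2⟩
    · rintro (h | h)
      · exact ⟨h.1, h.2.trans (mul_lt_mul_of_pos_left hy h.1)⟩
      · exact ⟨h.1, h.2.2⟩
  have hT_pos : 0 < ∫ pr in T, F pr := by
    rw [setIntegral_pos_iff_support_of_nonneg_ae
      (ae_restrict_of_forall_mem hT_open.measurableSet fun pr h => (hF_pos pr h).le) hT_int,
      inter_eq_right.2 (show T ⊆ Function.support F from fun pr h => (hF_pos pr h).ne')]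
    exact hT_open.measure_pos volume ⟨((y + y') / 2, 1), one_pos, by simp; linarith,
      by simp; linarith⟩
  rw [setIntegral_congr_set hunion,
    setIntegral_union hdisj hT_open.measurableSet (h_int y) hT_int]
  linarith

/-- Lemma 5(a): for a convex strictly bowl-shaped loss, the generalized Bayes function
`g`, defined by `B_m(y, g(y)) = 0` together with `y + c₀ + g(y) ≥ 0`, is strictly
decreasing. -/
theorem stmt9
    (f : ℝ → ℝ) (hf_meas : Measurable f) (hf_pos : ∀ t > (0 : ℝ), 0 < f t)
    (ρ ρd : ℝ → ℝ) (hρd_meas : Measurable ρd)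
    (hρ0 : ρ 0 = 0) (hρ_nonneg : ∀ t, 0 ≤ ρ t)
    (hρd_neg : ∀ t < (0 : ℝ), ρd t < 0) (hρd_pos : ∀ t > (0 : ℝ), 0 < ρd t)
    (hρ_ftc : ∀ a b : ℝ, ρ b - ρ a = ∫ t in a..b, ρd t)
    (hρd_mono : Monotone ρd)  -- convexity of ρ: ρ' is nondecreasing
    (c₀ : ℝ) (m : ℝ) (hm : 0 < m)
    (g : ℝ → ℝ)
    (hg_eq : ∀ y : ℝ, Bm f ρd c₀ m y (g y) = 0)
    (hg_pos : ∀ y : ℝ, 0 ≤ y + c₀ + g y)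
    -- absolute convergence of all the integrals defining B_m
    (h_int : ∀ w z : ℝ, IntegrableOn
      (fun pr : ℝ × ℝ => ρd (pr.1 + c₀ * pr.2 + z * pr.2) * pr.2 ^ m * f (pr.1 ^ 2 + pr.2 ^ 2))
      {pr : ℝ × ℝ | 0 < pr.2 ∧ pr.1 < pr.2 * w}) :
    StrictAnti g := by
  intro y y' hy
  by_contra! hle
  have hlt := Bm_lt_Bm_left f ρd hf_pos hρd_pos c₀ m (g y) (fun w => h_int w (g y)) hy (hg_pos y)
  have hmono := Bm_mono_right f ρd hf_pos hρd_mono c₀ m y' (h_int y') hle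
  linarith [hg_eq y, hg_eq y']
end
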